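/- arXiv:2109.00801 — 5 statements merged into one kernel-verified Lean document; each statement's English description precedes it below -/
import Mathlib

section
/- Let (A,(f)) be of reduced prismatic type and let B be a derived f-complete A-algebra with Tor_i^A(B, A/fA) = 0 for all i ≥ 1 and B/fB faithfully flat over A/fA. Write (−)^∧ for f-adic completion, C = (B ⊗_A B)^∧ and D = (B ⊗_A B ⊗_A B)^∧, with the A-algebra coface maps δ¹_0, δ¹_1 : B → C induced by b ↦ 1 ⊗ b and b ↦ b ⊗ 1 respectively, the maps δ²_0, δ²_1, δ²_2 : C → D induced by inserting 1 into the corresponding slot, and μ : C → B induced by the multiplication B ⊗_A B → B. Let M be a B-module which is f-adically complete with M/f^nM flat over B/f^nB for every n ≥ 1, and let ε : (M ⊗_A B)^∧ → (B ⊗_A M)^∧ be an isomorphism of C-modules (the source being the completed base change of M along δ¹_0 and the target along δ¹_1), such that the base change of ε along μ is the identity of M and the cocycle condition δ²_1*(ε) = δ²_2*(ε) ∘ δ²_0*(ε) holds among the completed base changes to D. Then there exists an A-module N, f-adically complete with N/f^nN flat over A/f^nA for every n ≥ 1, together with an isomorphism of B-modules (N ⊗_A B)^∧ ≅ M under which ε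 corresponds to the canonical descent datum of N (the isomorphism (N ⊗_A B ⊗_A B)^∧ ≅ (B ⊗_A N ⊗_A B)^∧ permuting factors, i.e. induced by the identity of N). -/
set_option synthInstance.maxHeartbeats 400000
set_option maxHeartbeats 1000000

open TensorProduct CategoryTheory

universe u

section Defs
variable (A : Type u) [CommRing A]

/-- `M` is derived `f`-complete: `Hom_A(A_f, M) = 0` and `Ext¹_A(A_f, M) = 0`,
where `A_f = A[1/f]`. -/
noncomputable def DerivedComplete (f : A) (M : Type u) [AddCommGroup M] [Module A M] : Prop :=
  (∀ g : Localization.Away f →ₗ[A] M, g = 0) ∧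
  Subsingleton (((Ext A (ModuleCat.{u} A) 1).obj
      (Opposite.op (ModuleCat.of A (Localization.Away f)))).obj (ModuleCat.of A M))

/-- `Tor_i^A(M, N) = 0` for all `i ≥ 1`. -/
noncomputable def TorVanish (M N : Type u) [AddCommGroup M] [Module A M]
    [AddCommGroup N] [Module A N] : Prop :=
  ∀ i : ℕ, 1 ≤ i →
    Subsingleton (((Tor (ModuleCat.{u} A) i).obj (ModuleCat.of A M)).obj (ModuleCat.of A N))

end Defs

variable (A : Type u) [CommRing A] (f : A)
variable (B : Type u) [CommRing B] [Algebra A B]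
variable (M : Type u) [AddCommGroup M] [Module B M] [Module A M]
  [IsScalarTower A B M] [SMulCommClass B A M]

/-- The action of `b₀ ⊗ b₁ ∈ C = B ⊗[A] B` on `M ⊗[A] B`, the base change of `M` along
`δ¹₀ : b ↦ 1 ⊗ b`: `(b₀ ⊗ b₁) • (m ⊗ b) = (b₁ • m) ⊗ (b₀ * b)`. -/
noncomputable def actX (b₀ b₁ : B) : M ⊗[A] B →ₗ[A] M ⊗[A] B :=
  TensorProduct.map (Algebra.lsmul A A M b₁) (LinearMap.mulLeft A b₀)

/-- The action of `b₀ ⊗ b₁ ∈ C = B ⊗[A] B` on `B ⊗[A] M`, the base change of `M` along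
`δ¹₁ : b ↦ b ⊗ 1`: `(b₀ ⊗ b₁) • (b ⊗ m) = (b₁ * b) ⊗ (b₀ • m)`. -/
noncomputable def actY (b₀ b₁ : B) : B ⊗[A] M →ₗ[A] B ⊗[A] M :=
  TensorProduct.map (LinearMap.mulLeft A b₁) (Algebra.lsmul A A M b₀)

/-- `M ⊗[A] B → M`, `m ⊗ b ↦ b • m`: base change along the multiplication `μ : C → B`. -/
noncomputable def collapseX : M ⊗[A] B →ₗ[A] M :=
  TensorProduct.lift ((Algebra.lsmul A A M).toLinearMap.flip)

/-- `B ⊗[A] M → M`, `b ⊗ m ↦ b • m`: base change along the multiplication `μ : C → B`. -/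
noncomputable def collapseY : B ⊗[A] M →ₗ[A] M :=
  TensorProduct.lift ((Algebra.lsmul A A M).toLinearMap)

/-- `B ⊗ M → (B ⊗ B) ⊗ M`, `b ⊗ m ↦ (b ⊗ b₁) ⊗ m`: inserting a spectator `b₁` in the middle
slot. -/
noncomputable def insMid (b₁ : B) : B ⊗[A] M →ₗ[A] (B ⊗[A] B) ⊗[A] M :=
  ((TensorProduct.assoc A B B M).symm).toLinearMap.comp
    (LinearMap.lTensor B (TensorProduct.mk A B M b₁))

/-- `M/JM` is flat over `R/J` iff `- ⊗ M` preserves injections of `R`-modules killed by `J`. -/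
lemma flat_quotient_tensor_iff {R : Type u} [CommRing R] (J : Ideal R) (M : Type u)
    [AddCommGroup M] [Module R M] :
    Module.Flat (R ⧸ J) ((R ⧸ J) ⊗[R] M) ↔
      ∀ (P Q : Type u) [AddCommGroup P] [Module R P] [AddCommGroup Q] [Module R Q]
        (u : P →ₗ[R] Q), Module.IsTorsionBySet R Q J → Function.Injective u →
        Function.Injective (u.rTensor M) := by
  have key : ∀ (P Q : Type u) [AddCommGroup P] [Module R P] [AddCommGroup Q] [Module R Q]
      [Module (R ⧸ J) P] [Module (R ⧸ J) Q] [IsScalarTower R (R ⧸ J) P]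
      [IsScalarTower R (R ⧸ J) Q] (u : P →ₗ[R ⧸ J] Q),
      Function.Injective (u.rTensor ((R ⧸ J) ⊗[R] M)) ↔
        Function.Injective ((u.restrictScalars R).rTensor M) := by
    intro P Q _ _ _ _ _ _ _ _ u
    have h : ((u.restrictScalars R).rTensor M) ∘
        (AlgebraTensorModule.cancelBaseChange R (R ⧸ J) (R ⧸ J) P M) =
        (AlgebraTensorModule.cancelBaseChange R (R ⧸ J) (R ⧸ J) Q M) ∘
          u.rTensor ((R ⧸ J) ⊗[R] M) := by
      funext x
      induction x with
      | zero => simp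
      | add x y hx hy => simp only [Function.comp_apply, map_add] at hx hy ⊢; rw [hx, hy]
      | tmul p y =>
        induction y with
        | zero => simp
        | add x y hx hy =>
          simp only [Function.comp_apply, tmul_add, map_add] at hx hy ⊢; rw [hx, hy]
        | tmul a m => simp
    rw [← EquivLike.comp_injective _ (AlgebraTensorModule.cancelBaseChange R (R ⧸ J) (R ⧸ J) Q M),
      ← h, EquivLike.injective_comp]
  constructor
  · intro hflat P Q _ _ _ _ u hQ hu
    have hP : Module.IsTorsionBySet R P J := fun {x a} => hu (by
      rw [map_smul, map_zero]; exact hQ (x := u x) (a := a))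
    let _ := hP.module
    let _ := hQ.module
    have : IsScalarTower R (R ⧸ J) P := hP.isScalarTower
    have : IsScalarTower R (R ⧸ J) Q := hQ.isScalarTower
    let u' : P →ₗ[R ⧸ J] Q := u.extendScalarsOfSurjective Ideal.Quotient.mk_surjective
    exact (key P Q u').1 (Module.Flat.rTensor_preserves_injective_linearMap u' hu)
  · intro h
    rw [Module.Flat.iff_rTensor_preserves_injective_linearMap]
    intro P Q _ _ _ _ u hu
    let _ : Module R P := Module.compHom P (Ideal.Quotient.mk J)
    let _ : Module R Q := Module.compHom Q (Ideal.Quotient.mk J)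
    have : IsScalarTower R (R ⧸ J) P := ⟨fun a b x => mul_smul (Ideal.Quotient.mk J a) b x⟩
    have : IsScalarTower R (R ⧸ J) Q := ⟨fun a b x => mul_smul (Ideal.Quotient.mk J a) b x⟩
    refine (key P Q u).2 (h P Q _ ?_ hu)
    intro x a
    change Ideal.Quotient.mk J a • x = 0
    rw [Ideal.Quotient.eq_zero_iff_mem.2 a.2, zero_smul]

section LocalCriterion
variable (R : Type u) [CommRing R]

/-- `E ⊗ -` keeps every short exact sequence with last term `Z` left exact
(that is, `Tor₁(E, Z) = 0`). -/
def TensorLeftExactAt (E : Type u) [AddCommGroup E] [Module R E]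
    (Z : Type u) [AddCommGroup Z] [Module R Z] : Prop :=
  ∀ (X Y : Type u) [AddCommGroup X] [Module R X] [AddCommGroup Y] [Module R Y]
    (i : X →ₗ[R] Y) (p : Y →ₗ[R] Z), Function.Injective i → Function.Exact i p →
    Function.Surjective p → Function.Injective (i.lTensor E)

variable {R} {E : Type u} [AddCommGroup E] [Module R E]

namespace TensorLeftExactAt

lemma of_projective (Z : Type u) [AddCommGroup Z] [Module R Z] [Module.Projective R Z] :
    TensorLeftExactAt R E Z := by
  intro X Y _ _ _ _ i p hi hip hp
  obtain ⟨s, hs⟩ := Module.projective_lifting_property p LinearMap.id hp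
  obtain ⟨-, r, hr⟩ := hip.split_tfae'.out 0 1 (a := Function.Injective i ∧ ∃ l, p ∘ₗ l = LinearMap.id)
    (b := Function.Surjective p ∧ ∃ l, l ∘ₗ i = LinearMap.id) |>.1 ⟨hi, s, hs⟩
  refine Function.LeftInverse.injective (f := i.lTensor E) (g := r.lTensor E) fun x => ?_
  rw [← LinearMap.comp_apply, ← LinearMap.lTensor_comp, hr, LinearMap.lTensor_id,
    LinearMap.id_apply]

lemma of_presentation {K G Z : Type u} [AddCommGroup K] [Module R K] [AddCommGroup G]
    [Module R G] [AddCommGroup Z] [Module R Z] (hG : TensorLeftExactAt R E G)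
    (j : K →ₗ[R] G) (q : G →ₗ[R] Z) (hjq : Function.Exact j q)
    (hq : Function.Surjective q) (hjB : Function.Injective (j.lTensor E)) :
    TensorLeftExactAt R E Z := by
  intro X Y _ _ _ _ i p hi hip hp
  let P : Submodule R (G × Y) :=
    LinearMap.eqLocus (q ∘ₗ LinearMap.fst R G Y) (p ∘ₗ LinearMap.snd R G Y)
  let a : X →ₗ[R] P := (LinearMap.inr R G Y ∘ₗ i).codRestrict P fun x => by
    change q 0 = p (i x)
    rw [map_zero, hip.apply_apply_eq_zero]
  let b : K →ₗ[R] P := (LinearMap.inl R G Y ∘ₗ j).codRestrict P fun x => by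
    change q (j x) = p 0
    rw [map_zero, hjq.apply_apply_eq_zero]
  let pG : P →ₗ[R] G := LinearMap.fst R G Y ∘ₗ P.subtype
  let pY : P →ₗ[R] Y := LinearMap.snd R G Y ∘ₗ P.subtype
  have ha : Function.Injective a := fun x y h => hi (congrArg (fun z : P => z.1.2) h)
  have haG : Function.Exact a pG := by
    rintro ⟨⟨g, y⟩, h⟩
    constructor
    · intro (h0 : g = 0)
      subst h0
      obtain ⟨x, rfl⟩ := (hip y).1 (by rw [← show q 0 = p y from h, map_zero])
      exact ⟨x, rfl⟩
    · rintro ⟨x, hx⟩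
      exact (congrArg (fun z : P => z.1.1) hx).symm
  have hbY : Function.Exact b pY := by
    rintro ⟨⟨g, y⟩, h⟩
    constructor
    · intro (h0 : y = 0)
      subst h0
      obtain ⟨x, rfl⟩ := (hjq g).1 (by rw [show q g = p 0 from h, map_zero])
      exact ⟨x, rfl⟩
    · rintro ⟨x, hx⟩
      exact (congrArg (fun z : P => z.1.2) hx).symm
  have hpG : Function.Surjective pG := fun g => by
    obtain ⟨y, hy⟩ := hp (q g)
    exact ⟨⟨(g, y), hy.symm⟩, rfl⟩
  have hpY : Function.Surjective pY := fun y => by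
    obtain ⟨g, hg⟩ := hq (p y)
    exact ⟨⟨(g, y), hg⟩, rfl⟩
  have hi' : pY ∘ₗ a = i := rfl
  have hj' : pG ∘ₗ b = j := rfl
  have h0 : pG ∘ₗ a = 0 := rfl
  rw [injective_iff_map_eq_zero]
  intro x hx
  rw [← hi', LinearMap.lTensor_comp, LinearMap.comp_apply] at hx
  obtain ⟨k, hk⟩ := (lTensor_exact E hbY hpY _).1 hx
  have hk0 : j.lTensor E k = 0 := by
    rw [← hj', LinearMap.lTensor_comp, LinearMap.comp_apply, hk, ← LinearMap.comp_apply,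
      ← LinearMap.lTensor_comp, h0, LinearMap.lTensor_zero, LinearMap.zero_apply]
  rw [(injective_iff_map_eq_zero _).1 hjB k hk0, map_zero] at hk
  exact (injective_iff_map_eq_zero _).1 (hG X P a pG ha haG hpG) x hk.symm

lemma of_extension {Z : Type u} [AddCommGroup Z] [Module R Z] (Z' : Submodule R Z)
    (h' : TensorLeftExactAt R E Z') (h'' : TensorLeftExactAt R E (Z ⧸ Z')) :
    TensorLeftExactAt R E Z := by
  intro X Y _ _ _ _ i p hi hip hp
  let Y' : Submodule R Y := Z'.comap p
  let i' : X →ₗ[R] Y' := i.codRestrict Y' fun x => by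
    change p (i x) ∈ Z'
    rw [hip.apply_apply_eq_zero]
    exact Z'.zero_mem
  let p' : Y' →ₗ[R] Z' := (p ∘ₗ Y'.subtype).codRestrict Z' fun y => y.2
  have h1 : Function.Injective (i'.lTensor E) := by
    refine h' X Y' i' p' (fun x y h => hi (congrArg Subtype.val h)) ?_ ?_
    · rintro ⟨y, hy⟩
      constructor
      · intro h0
        obtain ⟨x, rfl⟩ := (hip y).1 (congrArg Subtype.val h0)
        exact ⟨x, rfl⟩
      · rintro ⟨x, hx⟩
        refine Subtype.ext ?_
        have : i x = y := congrArg Subtype.val hx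
        change p y = 0
        rw [← this, hip.apply_apply_eq_zero]
    · rintro ⟨z, hz⟩
      obtain ⟨y, rfl⟩ := hp z
      exact ⟨⟨y, hz⟩, rfl⟩
  have h2 : Function.Injective (Y'.subtype.lTensor E) := by
    refine h'' Y' Y Y'.subtype (Z'.mkQ ∘ₗ p) Subtype.val_injective ?_
      (Z'.mkQ_surjective.comp hp)
    intro y
    rw [LinearMap.comp_apply, Submodule.mkQ_apply, Submodule.Quotient.mk_eq_zero]
    simp [Y']
  have h3 : Y'.subtype ∘ₗ i' = i := rfl
  rw [← h3, LinearMap.lTensor_comp]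
  exact h2.comp h1

end TensorLeftExactAt

lemma TensorLeftExactAt.tensor_of_presentation {W P : Type u} [AddCommGroup W] [Module R W]
    [AddCommGroup P] [Module R P] [Module.Projective R P] (q : P →ₗ[R] W)
    (hq : Function.Surjective q) (hqB : Function.Injective ((LinearMap.ker q).subtype.lTensor E))
    (S : Type u) [AddCommGroup S] [Module R S] [Module.Projective R S] :
    TensorLeftExactAt R E (W ⊗[R] S) := by
  refine .of_presentation (.of_projective (P ⊗[R] S)) ((LinearMap.ker q).subtype.rTensor S)
    (q.rTensor S) (rTensor_exact S (LinearMap.exact_subtype_ker_map q) hq)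
    (LinearMap.rTensor_surjective S hq) ?_
  have h := Module.Flat.rTensor_preserves_injective_linearMap (M := S) _ hqB
  have e : ((LinearMap.ker q).subtype.rTensor S).lTensor E ∘
      TensorProduct.assoc R E (LinearMap.ker q) S =
      TensorProduct.assoc R E P S ∘ ((LinearMap.ker q).subtype.lTensor E).rTensor S := by
    rw [← LinearEquiv.coe_toLinearMap, ← LinearEquiv.coe_toLinearMap, ← LinearMap.coe_comp,
      ← LinearMap.coe_comp]
    congr 1
    ext; simp
  rwa [← EquivLike.injective_comp (TensorProduct.assoc R E (LinearMap.ker q) S), e,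
    EquivLike.comp_injective]

lemma isTorsionBySet_quotient_tensor (J : Ideal R) (S : Type u) [AddCommGroup S] [Module R S] :
    Module.IsTorsionBySet R ((R ⧸ J) ⊗[R] S) J := by
  intro x a
  induction x with
  | zero => simp
  | add x y hx hy => rw [smul_add, hx, hy, add_zero]
  | tmul b s =>
    rw [smul_tmul']
    obtain ⟨b, rfl⟩ := Ideal.Quotient.mk_surjective b
    have : (a : R) • (Ideal.Quotient.mk J b) = 0 := by
      rw [Algebra.smul_def, Ideal.Quotient.algebraMap_eq, Ideal.Quotient.eq_zero_iff_mem.2 a.2,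
        zero_mul]
    rw [this, zero_tmul]

lemma exists_surjective_quotient_tensor {J : Ideal R} (Z : Type u) [AddCommGroup Z] [Module R Z]
    (hZ : Module.IsTorsionBySet R Z J) :
    ∃ c : (R ⧸ J) ⊗[R] (Z →₀ R) →ₗ[R] Z, Function.Surjective c := by
  let c' : (R ⧸ J) →ₗ[R] (Z →₀ R) →ₗ[R] Z := J.liftQ (LinearMap.toSpanSingleton R _
      (Finsupp.linearCombination R (id : Z → Z))) fun a ha => by
        rw [LinearMap.mem_ker]
        ext z
        simpa using hZ (x := z) (a := ⟨a, ha⟩)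
  refine ⟨TensorProduct.lift c', fun z => ⟨1 ⊗ₜ Finsupp.single z 1, ?_⟩⟩
  change (1 : R) • Finsupp.linearCombination R (id : Z → Z) (Finsupp.single z 1) = z
  simp

/-- If `Tor₁(E, R/J) = 0` and `E/JE` is flat over `R/J` then `Tor₁(E, Z) = 0` for every `Z` killed
by `J`. -/
lemma tensorLeftExactAt_of_isTorsionBySet {J : Ideal R}
    {P : Type u} [AddCommGroup P] [Module R P] [Module.Projective R P] (q : P →ₗ[R] (R ⧸ J))
    (hq : Function.Surjective q) (hqB : Function.Injective ((LinearMap.ker q).subtype.lTensor E))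
    (hflat : Module.Flat (R ⧸ J) ((R ⧸ J) ⊗[R] E))
    (Z : Type u) [AddCommGroup Z] [Module R Z] (hZ : Module.IsTorsionBySet R Z J) :
    TensorLeftExactAt R E Z := by
  obtain ⟨c, hc⟩ := exists_surjective_quotient_tensor Z hZ
  have h := (flat_quotient_tensor_iff J E).1 hflat (LinearMap.ker c) _ (LinearMap.ker c).subtype
    (isTorsionBySet_quotient_tensor J _) (LinearMap.ker c).injective_subtype
  rw [← LinearMap.lTensor_inj_iff_rTensor_inj] at h
  exact .of_presentation (K := LinearMap.ker c) (.tensor_of_presentation q hq hqB (Z →₀ R))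
    (LinearMap.ker c).subtype c (LinearMap.exact_subtype_ker_map c) hc h

open MonoidalCategory in
/-- If `Tor₁(E, Z) = 0` then a projective presentation of `Z` stays left exact after `E ⊗ -`. -/
lemma TorVanish.exists_projective_presentation {Z : Type u} [AddCommGroup Z] [Module R Z]
    (h : TorVanish R E Z) :
    ∃ (P : Type u) (_ : AddCommGroup P) (_ : Module R P) (q : P →ₗ[R] Z),
      Module.Projective R P ∧ Function.Surjective q ∧
      Function.Injective ((LinearMap.ker q).subtype.lTensor E) := by
  let res := projectiveResolution (ModuleCat.of R Z)
  let F := (tensoringLeft (ModuleCat.{u} R)).obj (ModuleCat.of R E)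
  have h1 : Limits.IsZero ((Functor.leftDerived F 1).obj (ModuleCat.of R Z)) := by
    have : Subsingleton ((Functor.leftDerived F 1).obj (ModuleCat.of R Z)) := h 1 le_rfl
    exact ModuleCat.isZero_of_subsingleton _
  have h2 : Limits.IsZero (((F.mapHomologicalComplex _).obj res.complex).homology 1) :=
    h1.of_iso (res.isoLeftDerivedObj F 1).symm
  have h3 := (HomologicalComplex.exactAt_iff_isZero_homology _ 1).2 h2
  have h4 := (HomologicalComplex.exactAt_iff' _ 2 1 0 (by simp) (by simp)).1 h3
  have h5 := (ShortComplex.ShortExact.moduleCat_exact_iff_function_exact _).1 h4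
  have h6 := res.exact₀
  have h7 := (ShortComplex.ShortExact.moduleCat_exact_iff_function_exact _).1 h6
  have h8 := (HomologicalComplex.exactAt_iff' _ 2 1 0 (by simp) (by simp)).1 (res.complex_exactAt_succ 0)
  have h9 := (ShortComplex.ShortExact.moduleCat_exact_iff_function_exact _).1 h8
  have hs : Function.Surjective (res.π.f 0).hom := (ModuleCat.epi_iff_surjective _).1 inferInstance
  let d1 : res.complex.X 1 →ₗ[R] res.complex.X 0 := (res.complex.d 1 0).hom
  let d2 : res.complex.X 2 →ₗ[R] res.complex.X 1 := (res.complex.d 2 1).hom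
  let q : res.complex.X 0 →ₗ[R] Z := (res.π.f 0).hom
  have e1 : Function.Exact d1 q := h7
  have e2 : Function.Exact d2 d1 := h9
  have e3 : Function.Exact (d2.lTensor E) (d1.lTensor E) := h5
  refine ⟨res.complex.X 0, inferInstance, inferInstance, q, ?_, hs, ?_⟩
  · exact (IsProjective.iff_projective _).2 (res.projective 0)
  · rw [injective_iff_map_eq_zero]
    intro x hx
    let d1' : res.complex.X 1 →ₗ[R] LinearMap.ker q :=
      d1.codRestrict _ fun y => (e1 (d1 y)).2 ⟨y, rfl⟩
    have hd1' : Function.Surjective d1' := by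
      rintro ⟨y, hy⟩
      obtain ⟨z, rfl⟩ := (e1 y).1 hy
      exact ⟨z, rfl⟩
    obtain ⟨y, rfl⟩ := LinearMap.lTensor_surjective E hd1' x
    have hc : (LinearMap.ker q).subtype ∘ₗ d1' = d1 := rfl
    rw [← LinearMap.comp_apply, ← LinearMap.lTensor_comp, hc] at hx
    obtain ⟨z, rfl⟩ := (e3 y).1 hx
    rw [← LinearMap.comp_apply, ← LinearMap.lTensor_comp]
    have : d1' ∘ₗ d2 = 0 := by
      ext z
      exact (e2 (d2 z)).2 ⟨z, rfl⟩
    rw [this, LinearMap.lTensor_zero, LinearMap.zero_apply]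

lemma tensorLeftExactAt_of_pow {f : R}
    (h : ∀ (Z : Type u) [AddCommGroup Z] [Module R Z], (∀ z : Z, f • z = 0) →
      TensorLeftExactAt R E Z) (n : ℕ) :
    ∀ (Z : Type u) [AddCommGroup Z] [Module R Z], (∀ z : Z, f ^ n • z = 0) →
      TensorLeftExactAt R E Z := by
  induction n with
  | zero => exact fun Z _ _ hZ => h Z fun z => by rw [← one_smul R z, ← pow_zero f, hZ, smul_zero]
  | succ n ih =>
    intro Z _ _ hZ
    refine .of_extension (LinearMap.range (LinearMap.lsmul R Z f)) (ih _ ?_) (h _ ?_)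
    · rintro ⟨_, z, rfl⟩
      refine Subtype.ext ?_
      change f ^ n • f • z = 0
      rw [smul_smul, ← pow_succ, hZ]
    · intro z
      obtain ⟨z, rfl⟩ := Submodule.Quotient.mk_surjective _ z
      rw [← Submodule.Quotient.mk_smul, Submodule.Quotient.mk_eq_zero]
      exact ⟨z, rfl⟩

end LocalCriterion

section TorsionFaithfullyFlat
variable {R : Type u} [CommRing R]

/-- `E ⊗ -` is exact and faithful on the modules killed by a power of `r`. -/
structure IsTorsionFaithfullyFlat (r : R) (E : Type u) [AddCommGroup E] [Module R E] : Prop where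
  rTensor_injective : ∀ (n : ℕ) {X Y : Type u} [AddCommGroup X] [Module R X] [AddCommGroup Y]
    [Module R Y] (u : X →ₗ[R] Y), (∀ y : Y, r ^ n • y = 0) → Function.Injective u →
    Function.Injective (u.rTensor E)
  subsingleton_of_tensor : ∀ (n : ℕ) (Y : Type u) [AddCommGroup Y] [Module R Y],
    (∀ y : Y, r ^ n • y = 0) → Subsingleton (Y ⊗[R] E) → Subsingleton Y

variable {r : R} {E : Type u} [AddCommGroup E] [Module R E]

lemma isTorsionBySet_span_of_smul_eq_zero {s : R} {Z : Type u} [AddCommGroup Z] [Module R Z]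
    (hZ : ∀ z : Z, s • z = 0) : Module.IsTorsionBySet R Z (Ideal.span {s} : Ideal R) := by
  rintro z ⟨a, ha⟩
  obtain ⟨b, rfl⟩ := Ideal.mem_span_singleton'.1 ha
  change (b * s) • z = 0
  rw [mul_smul, hZ, smul_zero]

lemma IsTorsionFaithfullyFlat.of_torVanish
    (hTor : TorVanish R E (R ⧸ Ideal.span {r}))
    (hff : Module.FaithfullyFlat (R ⧸ Ideal.span {r}) ((R ⧸ Ideal.span {r}) ⊗[R] E)) :
    IsTorsionFaithfullyFlat r E := by
  have hgood : ∀ (n : ℕ) (Z : Type u) [AddCommGroup Z] [Module R Z], (∀ z : Z, r ^ n • z = 0) →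
      TensorLeftExactAt R E Z := by
    refine tensorLeftExactAt_of_pow fun Z _ _ hZ => ?_
    obtain ⟨P, _, _, q, _, hq, hqE⟩ := hTor.exists_projective_presentation
    exact tensorLeftExactAt_of_isTorsionBySet q hq hqE inferInstance Z
      (isTorsionBySet_span_of_smul_eq_zero hZ)
  constructor
  · intro n X Y _ _ _ _ u hY hu
    rw [← LinearMap.lTensor_inj_iff_rTensor_inj]
    refine hgood n (Y ⧸ LinearMap.range u) (fun z => ?_) X Y u (LinearMap.range u).mkQ hu
      (LinearMap.exact_map_mkQ_range u) (Submodule.mkQ_surjective _)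
    obtain ⟨y, rfl⟩ := Submodule.Quotient.mk_surjective _ z
    rw [← Submodule.Quotient.mk_smul, hY, Submodule.Quotient.mk_zero]
  · intro n Y _ _ hY hs
    let S : Submodule R Y := LinearMap.range (LinearMap.lsmul R Y r)
    have hS : Subsingleton (Y ⧸ S) := by
      have h1 : Subsingleton ((Y ⧸ S) ⊗[R] E) :=
        (LinearMap.rTensor_surjective E S.mkQ_surjective).subsingleton
      have htors : Module.IsTorsionBySet R (Y ⧸ S) (Ideal.span {r} : Ideal R) := by
        refine isTorsionBySet_span_of_smul_eq_zero fun z => ?_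
        obtain ⟨y, rfl⟩ := Submodule.Quotient.mk_surjective _ z
        rw [← Submodule.Quotient.mk_smul, Submodule.Quotient.mk_eq_zero]
        exact ⟨y, rfl⟩
      let _ := htors.module
      have : IsScalarTower R (R ⧸ Ideal.span {r}) (Y ⧸ S) := htors.isScalarTower
      have h2 := (AlgebraTensorModule.cancelBaseChange R (R ⧸ Ideal.span {r})
        (R ⧸ Ideal.span {r}) (Y ⧸ S) E).injective.subsingleton
      exact Module.FaithfullyFlat.rTensor_reflects_triviality (R ⧸ Ideal.span {r})
        ((R ⧸ Ideal.span {r}) ⊗[R] E) (Y ⧸ S)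
    have hstep : ∀ y : Y, ∃ z, r • z = y := fun y =>
      (Submodule.Quotient.mk_eq_zero S).1 (Subsingleton.elim (Submodule.Quotient.mk y) 0)
    have hpow : ∀ (k : ℕ) (y : Y), ∃ z, r ^ k • z = y := by
      intro k
      induction k with
      | zero => exact fun y => ⟨y, by simp⟩
      | succ k ih =>
        intro y
        obtain ⟨z, rfl⟩ := ih y
        obtain ⟨w, rfl⟩ := hstep z
        exact ⟨w, by rw [pow_succ, mul_smul]⟩
    refine subsingleton_of_forall_eq 0 fun y => ?_
    obtain ⟨z, rfl⟩ := hpow n y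
    exact hY z

variable (hE : IsTorsionFaithfullyFlat r E)
include hE

lemma IsTorsionFaithfullyFlat.surjective_of_rTensor {n : ℕ} {X Y : Type u} [AddCommGroup X]
    [Module R X] [AddCommGroup Y] [Module R Y] (u : X →ₗ[R] Y) (hY : ∀ y : Y, r ^ n • y = 0)
    (hu : Function.Surjective (u.rTensor E)) : Function.Surjective u := by
  have h : Subsingleton ((Y ⧸ LinearMap.range u) ⊗[R] E) := by
    refine subsingleton_of_forall_eq 0 fun x => ?_
    obtain ⟨y, rfl⟩ := LinearMap.rTensor_surjective E (LinearMap.range u).mkQ_surjective x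
    obtain ⟨z, rfl⟩ := hu y
    rw [← LinearMap.comp_apply, ← LinearMap.rTensor_comp, LinearMap.range_mkQ_comp,
      LinearMap.rTensor_zero, LinearMap.zero_apply]
  have h' := hE.subsingleton_of_tensor n (Y ⧸ LinearMap.range u) (fun z => by
    obtain ⟨y, rfl⟩ := Submodule.Quotient.mk_surjective _ z
    rw [← Submodule.Quotient.mk_smul, hY, Submodule.Quotient.mk_zero]) h
  rw [← LinearMap.range_eq_top]
  exact Submodule.Quotient.subsingleton_iff.1 h'

lemma IsTorsionFaithfullyFlat.injective_of_rTensor {n : ℕ} {X Y : Type u} [AddCommGroup X]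
    [Module R X] [AddCommGroup Y] [Module R Y] (u : X →ₗ[R] Y) (hX : ∀ x : X, r ^ n • x = 0)
    (hu : Function.Injective (u.rTensor E)) : Function.Injective u := by
  rw [← LinearMap.ker_eq_bot, ← Submodule.subsingleton_iff_eq_bot]
  refine hE.subsingleton_of_tensor n _ (fun y => Subtype.ext (hX y)) ?_
  refine subsingleton_of_forall_eq 0 fun x => ?_
  refine hE.rTensor_injective n (LinearMap.ker u).subtype hX Subtype.val_injective (hu ?_)
  rw [← LinearMap.comp_apply, ← LinearMap.rTensor_comp, LinearMap.comp_ker_subtype]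
  simp

end TorsionFaithfullyFlat

lemma rTensor_exact_of_injective_range {R : Type*} [CommRing R] (E : Type*) [AddCommGroup E]
    [Module R E] {X Y Z : Type*} [AddCommGroup X] [Module R X] [AddCommGroup Y] [Module R Y]
    [AddCommGroup Z] [Module R Z] {i : X →ₗ[R] Y} {d : Y →ₗ[R] Z} (h : Function.Exact i d)
    (hd : Function.Injective ((LinearMap.range d).subtype.rTensor E)) :
    Function.Exact (i.rTensor E) (d.rTensor E) := by
  have h1 : Function.Exact i d.rangeRestrict := fun w => by
    rw [← h w, ← Subtype.coe_inj]; rfl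
  have h2 := rTensor_exact E h1 d.surjective_rangeRestrict
  intro x
  rw [← h2 x, ← map_eq_zero_iff _ hd, ← LinearMap.comp_apply, ← LinearMap.rTensor_comp]
  rfl

section FiniteLevel
variable {A : Type u} [CommRing A] {f : A} {B : Type u} [CommRing B] [Algebra A B]
variable {W : Type u} [AddCommGroup W] [Module A W]

/-- The elements `w` with `φ (w ⊗ 1) = 1 ⊗ w`. -/
noncomputable def descentInvariants (φ : W ⊗[A] B →ₗ[A] B ⊗[A] W) : Submodule A W :=
  LinearMap.eqLocus (φ ∘ₗ (TensorProduct.mk A W B).flip 1) (TensorProduct.mk A B W 1)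

lemma mem_descentInvariants {φ : W ⊗[A] B →ₗ[A] B ⊗[A] W} {w : W} :
    w ∈ descentInvariants φ ↔ φ (w ⊗ₜ 1) = 1 ⊗ₜ w := Iff.rfl

variable [Module B W] [IsScalarTower A B W] [SMulCommClass B A W]

/-- `n ⊗ b ↦ b • n`. -/
noncomputable def extendSubmodule (N : Submodule A W) : N ⊗[A] B →ₗ[A] W :=
  collapseX A B W ∘ₗ N.subtype.rTensor B

@[simp] lemma extendSubmodule_tmul (N : Submodule A W) (n : N) (b : B) :
    extendSubmodule N (n ⊗ₜ[A] b) = b • (n : W) := by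
  simp [extendSubmodule, collapseX]

lemma apply_tmul_of_mem_descentInvariants {φ : W ⊗[A] B →ₗ[A] B ⊗[A] W}
    (hlin : ∀ b₀ b₁ z, φ (actX A B W b₀ b₁ z) = actY A B W b₀ b₁ (φ z))
    {w : W} (hw : w ∈ descentInvariants φ) (β b : B) :
    φ ((β • w) ⊗ₜ b) = β ⊗ₜ (b • w) := by
  have h := hlin b β (w ⊗ₜ 1)
  rw [mem_descentInvariants.1 hw] at h
  simpa [actX, actY] using h

variable (hB : IsTorsionFaithfullyFlat f B)
include hB

/-- Faithfully flat descent for modules killed by a power of `f`. -/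
theorem bijective_extendSubmodule_descentInvariants {n : ℕ} (hW : ∀ w : W, f ^ n • w = 0)
    (φ : W ⊗[A] B ≃ₗ[A] B ⊗[A] W)
    (hlin : ∀ b₀ b₁ z, φ (actX A B W b₀ b₁ z) = actY A B W b₀ b₁ (φ z))
    (hcoc : ∀ (w : W) (b : B),
      insMid A B W 1 (φ (w ⊗ₜ b)) = (TensorProduct.assoc A B B W).symm
        (φ.toLinearMap.lTensor B (TensorProduct.assoc A B W B (φ (w ⊗ₜ 1) ⊗ₜ b)))) :
    Function.Bijective (extendSubmodule (B := B) (descentInvariants φ.toLinearMap)) := by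
  set N := descentInvariants φ.toLinearMap with hN
  have hsub : Function.Injective (N.subtype.rTensor B) :=
    hB.rTensor_injective n N.subtype hW N.injective_subtype
  have hφN : ∀ t : N ⊗[A] B, φ (N.subtype.rTensor B t) = 1 ⊗ₜ extendSubmodule N t := by
    intro t
    induction t with
    | zero => simp
    | add x y hx hy => rw [map_add, map_add, map_add, tmul_add, hx, hy]
    | tmul w b =>
      have := apply_tmul_of_mem_descentInvariants hlin w.2 1 b
      simpa using this
  let δ : W →ₗ[A] B ⊗[A] W :=
    φ.toLinearMap ∘ₗ (TensorProduct.mk A W B).flip 1 - TensorProduct.mk A B W 1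
  have hδ : Function.Exact N.subtype δ := by
    intro w
    simp only [δ, LinearMap.sub_apply, sub_eq_zero]
    exact ⟨fun h => ⟨⟨w, h⟩, rfl⟩, by rintro ⟨w, rfl⟩; exact w.2⟩
  have hδB : Function.Exact (N.subtype.rTensor B) (δ.rTensor B) := by
    refine rTensor_exact_of_injective_range B hδ ?_
    have htor : ∀ y : B ⊗[A] W, f ^ n • y = 0 := fun y => by
      induction y with
      | zero => simp
      | add x y hx hy => rw [smul_add, hx, hy, add_zero]
      | tmul b w => rw [← tmul_smul, hW, tmul_zero]
    exact hB.rTensor_injective n (Submodule.subtype _) htor (Submodule.injective_subtype _)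
  have hkey : ∀ x : W ⊗[A] B, (TensorProduct.assoc A B B W).symm
      (φ.toLinearMap.lTensor B (TensorProduct.assoc A B W B (δ.rTensor B x))) =
      insMid A B W 1 (φ x) - (TensorProduct.assoc A B B W).symm (1 ⊗ₜ φ x) := by
    intro x
    induction x with
    | zero => simp
    | add x y hx hy => simp only [map_add, tmul_add, hx, hy]; abel
    | tmul w b =>
      rw [hcoc, LinearMap.rTensor_tmul]
      simp [δ, sub_tmul]
  have hcontr : ∀ y : B ⊗[A] W, (collapseY A B W).lTensor B
      ((TensorProduct.assoc A B B W) (insMid A B W 1 y)) = y := by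
    intro y
    induction y with
    | zero => simp
    | add x y hx hy => simp only [map_add, hx, hy]
    | tmul b w => simp [insMid, collapseY]
  have hker : ∀ x : W ⊗[A] B, δ.rTensor B x = 0 ↔ φ x = 1 ⊗ₜ collapseY A B W (φ x) := by
    intro x
    have hinj : Function.Injective (φ.toLinearMap.lTensor B) := (φ.lTensor B).injective
    rw [← map_eq_zero_iff _ (TensorProduct.assoc A B W B).injective, ← map_eq_zero_iff _ hinj,
      ← map_eq_zero_iff _ (TensorProduct.assoc A B B W).symm.injective, hkey, sub_eq_zero]
    constructor
    · intro h
      have := hcontr (φ x)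
      rw [h] at this
      simpa using this.symm
    · intro h
      rw [h]
      simp [insMid]
  constructor
  · rw [injective_iff_map_eq_zero]
    intro t ht
    have := hφN t
    rw [ht, tmul_zero, LinearEquiv.map_eq_zero_iff] at this
    exact (map_eq_zero_iff _ hsub).1 this
  · intro w
    have hx : δ.rTensor B (φ.symm (1 ⊗ₜ w)) = 0 := by
      rw [hker, LinearEquiv.apply_symm_apply]
      simp [collapseY]
    obtain ⟨t, ht⟩ := (hδB _).1 hx
    refine ⟨t, ?_⟩
    have := hφN t
    rw [ht, LinearEquiv.apply_symm_apply] at this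
    have := congrArg (collapseY A B W) this
    simpa [collapseY] using this.symm

end FiniteLevel

section PrincipalCompletion
variable {R : Type u} [CommRing R] {r : R}
variable {X : Type u} [AddCommGroup X] [Module R X] {Y : Type u} [AddCommGroup Y] [Module R Y]

lemma mem_span_singleton_pow_smul_top {n : ℕ} {x : X} :
    x ∈ (Ideal.span {r} ^ n • ⊤ : Submodule R X) ↔ ∃ y : X, r ^ n • y = x := by
  rw [Ideal.span_singleton_pow, Submodule.ideal_span_singleton_smul,
    Submodule.mem_smul_pointwise_iff_exists]
  simp

lemma AdicCompletion.exists_eq_of_add_smul (n : ℕ) (z : AdicCompletion (Ideal.span {r}) X) :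
    ∃ x z', z = AdicCompletion.of (Ideal.span {r}) X x + r ^ n • z' := by
  obtain ⟨x, hx⟩ := Submodule.mkQ_surjective _ (AdicCompletion.eval (Ideal.span {r}) X n z)
  have hz : z - AdicCompletion.of (Ideal.span {r}) X x ∈
      LinearMap.ker (AdicCompletion.eval (Ideal.span {r}) X n) := by
    rw [LinearMap.mem_ker, map_sub, AdicCompletion.eval_of, hx, sub_self]
  rw [← AdicCompletion.pow_smul_top_eq_ker_eval ⟨{r}, by simp⟩,
    mem_span_singleton_pow_smul_top] at hz
  obtain ⟨z', hz'⟩ := hz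
  exact ⟨x, z', by rw [hz', add_sub_cancel]⟩

lemma AdicCompletion.eq_of_forall_of {n : ℕ} (hY : ∀ y : Y, r ^ n • y = 0)
    {u v : AdicCompletion (Ideal.span {r}) X →ₗ[R] Y}
    (h : ∀ x, u (AdicCompletion.of (Ideal.span {r}) X x) =
      v (AdicCompletion.of (Ideal.span {r}) X x)) : u = v := by
  refine LinearMap.ext fun z => ?_
  obtain ⟨x, z', rfl⟩ := AdicCompletion.exists_eq_of_add_smul n z
  rw [map_add, map_add, h, map_smul, map_smul, hY, hY]

/-- The extension to the completion of a map into a module killed by `r ^ n`. -/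
noncomputable def AdicCompletion.liftOfSMulEqZero (u : X →ₗ[R] Y) {n : ℕ}
    (hY : ∀ y : Y, r ^ n • y = 0) : AdicCompletion (Ideal.span {r}) X →ₗ[R] Y :=
  (Submodule.liftQ _ u (by
    intro x hx
    obtain ⟨y, rfl⟩ := mem_span_singleton_pow_smul_top.1 hx
    rw [LinearMap.mem_ker, map_smul, hY])) ∘ₗ AdicCompletion.eval (Ideal.span {r}) X n

@[simp] lemma AdicCompletion.liftOfSMulEqZero_of (u : X →ₗ[R] Y) {n : ℕ}
    (hY : ∀ y : Y, r ^ n • y = 0) (x : X) :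
    AdicCompletion.liftOfSMulEqZero u hY (AdicCompletion.of (Ideal.span {r}) X x) = u x := rfl

lemma AdicCompletion.liftOfSMulEqZero_eq_zero_iff {u : X →ₗ[R] Y} {n : ℕ}
    (hY : ∀ y : Y, r ^ n • y = 0) (hu : ∀ x, u x = 0 → ∃ y, r ^ n • y = x)
    {z : AdicCompletion (Ideal.span {r}) X} :
    AdicCompletion.liftOfSMulEqZero u hY z = 0 ↔ ∃ z', r ^ n • z' = z := by
  constructor
  · intro hz
    obtain ⟨x, z', rfl⟩ := AdicCompletion.exists_eq_of_add_smul n z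
    rw [map_add, map_smul, hY, add_zero, AdicCompletion.liftOfSMulEqZero_of] at hz
    obtain ⟨y, rfl⟩ := hu x hz
    exact ⟨AdicCompletion.of (Ideal.span {r}) X y + z', by rw [smul_add, map_smul]⟩
  · rintro ⟨z', rfl⟩
    rw [map_smul, hY]

/-- An isomorphism of completions induces isomorphisms modulo `r ^ n`. -/
lemma AdicCompletion.exists_linearEquiv_of_linearEquiv {X' Y' : Type u} [AddCommGroup X']
    [Module R X'] [AddCommGroup Y'] [Module R Y']
    (e : AdicCompletion (Ideal.span {r}) X ≃ₗ[R] AdicCompletion (Ideal.span {r}) Y) {n : ℕ}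
    {p : X →ₗ[R] X'} (hp : Function.Surjective p) (hX' : ∀ x : X', r ^ n • x = 0)
    (hpk : ∀ x, p x = 0 → ∃ y, r ^ n • y = x)
    {q : Y →ₗ[R] Y'} (hq : Function.Surjective q) (hY' : ∀ y : Y', r ^ n • y = 0)
    (hqk : ∀ x, q x = 0 → ∃ y, r ^ n • y = x) :
    ∃ φ : X' ≃ₗ[R] Y', ∀ z, φ (AdicCompletion.liftOfSMulEqZero p hX' z) =
      AdicCompletion.liftOfSMulEqZero q hY' (e z) := by
  let p' : AdicCompletion (Ideal.span {r}) X →ₗ[R] X' := AdicCompletion.liftOfSMulEqZero p hX'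
  let q' : AdicCompletion (Ideal.span {r}) X →ₗ[R] Y' :=
    AdicCompletion.liftOfSMulEqZero q hY' ∘ₗ e.toLinearMap
  have hp' : Function.Surjective p' := fun x => by
    obtain ⟨x, rfl⟩ := hp x
    exact ⟨AdicCompletion.of _ _ x, rfl⟩
  have hq' : Function.Surjective q' := fun y => by
    obtain ⟨y, rfl⟩ := hq y
    exact ⟨e.symm (AdicCompletion.of _ _ y), by simp [q']⟩
  have hk : LinearMap.ker p' = LinearMap.ker q' := by
    ext z
    rw [LinearMap.mem_ker, LinearMap.mem_ker]
    refine (AdicCompletion.liftOfSMulEqZero_eq_zero_iff hX' hpk).trans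
      (Iff.trans ?_ (AdicCompletion.liftOfSMulEqZero_eq_zero_iff hY' hqk).symm)
    constructor
    · rintro ⟨z', rfl⟩
      exact ⟨e z', (map_smul e _ _).symm⟩
    · rintro ⟨z', hz'⟩
      exact ⟨e.symm z', e.injective (by simpa using hz')⟩
  refine ⟨(p'.quotKerEquivOfSurjective hp').symm ≪≫ₗ Submodule.quotEquivOfEq _ _ hk ≪≫ₗ
    q'.quotKerEquivOfSurjective hq', fun z => ?_⟩
  have : (p'.quotKerEquivOfSurjective hp').symm (p' z) = Submodule.Quotient.mk z := by
    rw [LinearEquiv.symm_apply_eq]; rfl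
  change (q'.quotKerEquivOfSurjective hq') (Submodule.quotEquivOfEq _ _ hk
    ((p'.quotKerEquivOfSurjective hp').symm (p' z))) = q' z
  rw [this]; rfl

lemma exists_smul_of_rTensor_eq_zero {Z : Type u} [AddCommGroup Z] [Module R Z] {n : ℕ}
    {p : X →ₗ[R] Y} (hp : Function.Surjective p) (hpk : ∀ x, p x = 0 ↔ ∃ y, r ^ n • y = x)
    (t : X ⊗[R] Z) (ht : p.rTensor Z t = 0) : ∃ s, r ^ n • s = t := by
  have hex : Function.Exact (r ^ n • LinearMap.id : X →ₗ[R] X) p := fun x => by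
    rw [hpk]; rfl
  obtain ⟨s, hs⟩ := (rTensor_exact Z hex hp t).1 ht
  exact ⟨s, by simpa [LinearMap.rTensor_smul] using hs⟩

lemma exists_smul_of_lTensor_eq_zero {Z : Type u} [AddCommGroup Z] [Module R Z] {n : ℕ}
    {p : X →ₗ[R] Y} (hp : Function.Surjective p) (hpk : ∀ x, p x = 0 ↔ ∃ y, r ^ n • y = x)
    (t : Z ⊗[R] X) (ht : p.lTensor Z t = 0) : ∃ s, r ^ n • s = t := by
  have hex : Function.Exact (r ^ n • LinearMap.id : X →ₗ[R] X) p := fun x => by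
    rw [hpk]; rfl
  obtain ⟨s, hs⟩ := (lTensor_exact Z hex hp t).1 ht
  exact ⟨s, by simpa [LinearMap.lTensor_smul] using hs⟩

lemma smul_tensor_eq_zero_left {s : R} (hX : ∀ x : X, s • x = 0) (t : X ⊗[R] Y) : s • t = 0 := by
  induction t with
  | zero => simp
  | add x y hx hy => rw [smul_add, hx, hy, add_zero]
  | tmul x y => rw [smul_tmul', hX, zero_tmul]

lemma smul_tensor_eq_zero_right {s : R} (hY : ∀ y : Y, s • y = 0) (t : X ⊗[R] Y) :
    s • t = 0 := by
  induction t with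
  | zero => simp
  | add x y hx hy => rw [smul_add, hx, hy, add_zero]
  | tmul x y => rw [← tmul_smul, hY, tmul_zero]

end PrincipalCompletion

section DescentDatum
variable {A : Type u} [CommRing A] {f : A} {B : Type u} [CommRing B] [Algebra A B]
variable {M : Type u} [AddCommGroup M] [Module A M]

/-- `m ↦ ε (m ⊗ 1) - 1 ⊗ m`. Its kernel is the module to which the descent datum `ε` descends. -/
noncomputable def descentDefect (ε : AdicCompletion (Ideal.span {f}) (M ⊗[A] B) ≃ₗ[A]
    AdicCompletion (Ideal.span {f}) (B ⊗[A] M)) :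
    M →ₗ[A] AdicCompletion (Ideal.span {f}) (B ⊗[A] M) :=
  ε.toLinearMap ∘ₗ AdicCompletion.of (Ideal.span {f}) (M ⊗[A] B) ∘ₗ
    (TensorProduct.mk A M B).flip 1 -
  AdicCompletion.of (Ideal.span {f}) (B ⊗[A] M) ∘ₗ TensorProduct.mk A B M 1

variable {ε : AdicCompletion (Ideal.span {f}) (M ⊗[A] B) ≃ₗ[A]
      AdicCompletion (Ideal.span {f}) (B ⊗[A] M)}

lemma descentDefect_apply (m : M) : descentDefect ε m =
    ε (AdicCompletion.of (Ideal.span {f}) (M ⊗[A] B) (m ⊗ₜ 1)) -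
      AdicCompletion.of (Ideal.span {f}) (B ⊗[A] M) (1 ⊗ₜ m) := rfl

variable [Module B M] [IsScalarTower A B M] [SMulCommClass B A M]

lemma apply_of_tmul_of_mem_ker_descentDefect
    (hlin : ∀ (b₀ b₁ : B) (z : AdicCompletion (Ideal.span {f}) (M ⊗[A] B)),
      ε (AdicCompletion.map (Ideal.span {f}) (actX A B M b₀ b₁) z) =
        AdicCompletion.map (Ideal.span {f}) (actY A B M b₀ b₁) (ε z))
    {m : M} (hm : m ∈ LinearMap.ker (descentDefect ε)) (β b : B) :
    ε (AdicCompletion.of (Ideal.span {f}) (M ⊗[A] B) ((β • m) ⊗ₜ b)) =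
      AdicCompletion.of (Ideal.span {f}) (B ⊗[A] M) (β ⊗ₜ (b • m)) := by
  have h := hlin b β (AdicCompletion.of (Ideal.span {f}) (M ⊗[A] B) (m ⊗ₜ 1))
  rw [LinearMap.mem_ker, descentDefect_apply, sub_eq_zero] at hm
  rw [hm, AdicCompletion.map_of, AdicCompletion.map_of] at h
  simpa [actX, actY] using h

variable {W : Type u} [AddCommGroup W] [Module B W] [Module A W] [IsScalarTower A B W]
  [SMulCommClass B A W]

lemma exists_descentDatum_mod_pow
    (hlin : ∀ (b₀ b₁ : B) (z : AdicCompletion (Ideal.span {f}) (M ⊗[A] B)),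
      ε (AdicCompletion.map (Ideal.span {f}) (actX A B M b₀ b₁) z) =
        AdicCompletion.map (Ideal.span {f}) (actY A B M b₀ b₁) (ε z))
    (hcoc : ∃ (ε₀₁ : AdicCompletion (Ideal.span {f}) ((M ⊗[A] B) ⊗[A] B) →ₗ[A]
          AdicCompletion (Ideal.span {f}) ((B ⊗[A] M) ⊗[A] B))
        (ε₁₂ : AdicCompletion (Ideal.span {f}) (B ⊗[A] (M ⊗[A] B)) →ₗ[A]
          AdicCompletion (Ideal.span {f}) (B ⊗[A] (B ⊗[A] M)))
        (ε₀₂ : AdicCompletion (Ideal.span {f}) ((M ⊗[A] B) ⊗[A] B) →ₗ[A]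
          AdicCompletion (Ideal.span {f}) ((B ⊗[A] B) ⊗[A] M)),
      (∀ (x : M ⊗[A] B) (b : B),
        ε₀₁ (AdicCompletion.of (Ideal.span {f}) ((M ⊗[A] B) ⊗[A] B) (x ⊗ₜ[A] b)) =
          AdicCompletion.map (Ideal.span {f}) ((TensorProduct.mk A (B ⊗[A] M) B).flip b)
            (ε (AdicCompletion.of (Ideal.span {f}) (M ⊗[A] B) x))) ∧
      (∀ (b : B) (x : M ⊗[A] B),
        ε₁₂ (AdicCompletion.of (Ideal.span {f}) (B ⊗[A] (M ⊗[A] B)) (b ⊗ₜ[A] x)) =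
          AdicCompletion.map (Ideal.span {f}) (TensorProduct.mk A B (B ⊗[A] M) b)
            (ε (AdicCompletion.of (Ideal.span {f}) (M ⊗[A] B) x))) ∧
      (∀ (m : M) (b₁ b₂ : B),
        ε₀₂ (AdicCompletion.of (Ideal.span {f}) ((M ⊗[A] B) ⊗[A] B)
            ((m ⊗ₜ[A] b₁) ⊗ₜ[A] b₂)) =
          AdicCompletion.map (Ideal.span {f}) (insMid A B M b₁)
            (ε (AdicCompletion.of (Ideal.span {f}) (M ⊗[A] B) (m ⊗ₜ[A] b₂)))) ∧
      (∀ z : AdicCompletion (Ideal.span {f}) ((M ⊗[A] B) ⊗[A] B),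
        ε₀₂ z =
          AdicCompletion.map (Ideal.span {f}) ((TensorProduct.assoc A B B M).symm.toLinearMap)
            (ε₁₂ (AdicCompletion.map (Ideal.span {f})
              ((TensorProduct.assoc A B M B).toLinearMap) (ε₀₁ z)))))
    {n : ℕ} (hW : ∀ w : W, f ^ n • w = 0) (π : M →ₗ[B] W) (hπ : Function.Surjective π)
    (hπk : ∀ x, π x = 0 ↔ ∃ y, f ^ n • y = x) :
    ∃ φ : W ⊗[A] B ≃ₗ[A] B ⊗[A] W,
      (∀ t : M ⊗[A] B, φ ((π.restrictScalars A).rTensor B t) =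
        AdicCompletion.liftOfSMulEqZero ((π.restrictScalars A).lTensor B)
          (smul_tensor_eq_zero_right hW) (ε (AdicCompletion.of (Ideal.span {f}) _ t))) ∧
      (∀ b₀ b₁ z, φ (actX A B W b₀ b₁ z) = actY A B W b₀ b₁ (φ z)) ∧
      (∀ (w : W) (b : B), insMid A B W 1 (φ (w ⊗ₜ b)) = (TensorProduct.assoc A B B W).symm
        (φ.toLinearMap.lTensor B (TensorProduct.assoc A B W B (φ (w ⊗ₜ 1) ⊗ₜ b)))) := by
  set πA : M →ₗ[A] W := π.restrictScalars A with hπA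
  have hπAs : Function.Surjective πA := hπ
  have hπA_apply : ∀ m, πA m = π m := fun _ => rfl
  let ρ := AdicCompletion.liftOfSMulEqZero (πA.lTensor B) (smul_tensor_eq_zero_right hW)
  let mapA {X Y : Type u} [AddCommGroup X] [Module A X] [AddCommGroup Y] [Module A Y]
      (u : X →ₗ[A] Y) : AdicCompletion (Ideal.span {f}) X →ₗ[A] AdicCompletion (Ideal.span {f}) Y :=
    (AdicCompletion.map (Ideal.span {f}) u).restrictScalars A
  have hmapA {X Y : Type u} [AddCommGroup X] [Module A X] [AddCommGroup Y] [Module A Y]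
      (u : X →ₗ[A] Y) (z) : mapA u z = AdicCompletion.map (Ideal.span {f}) u z := rfl
  have hρ : ∀ t, ρ (AdicCompletion.of _ _ t) = πA.lTensor B t := fun _ => rfl
  have hBB : ∀ t : (B ⊗[A] B) ⊗[A] W, f ^ n • t = 0 := smul_tensor_eq_zero_right hW
  have hBW : ∀ t : B ⊗[A] W, f ^ n • t = 0 := smul_tensor_eq_zero_right hW
  obtain ⟨φ, hφ⟩ := AdicCompletion.exists_linearEquiv_of_linearEquiv ε
    (LinearMap.rTensor_surjective B hπAs) (smul_tensor_eq_zero_left hW)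
    (exists_smul_of_rTensor_eq_zero hπAs hπk)
    (LinearMap.lTensor_surjective B hπAs) (smul_tensor_eq_zero_right hW)
    (exists_smul_of_lTensor_eq_zero hπAs hπk)
  have hφof : ∀ t : M ⊗[A] B, φ (πA.rTensor B t) = ρ (ε (AdicCompletion.of _ _ t)) :=
    fun t => hφ (AdicCompletion.of _ _ t)
  have hφtmul : ∀ m b, φ (π m ⊗ₜ b) = ρ (ε (AdicCompletion.of _ _ (m ⊗ₜ b))) :=
    fun m b => hφof (m ⊗ₜ b)
  refine ⟨φ, hφof, fun b₀ b₁ z => ?_, fun w b => ?_⟩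
  · obtain ⟨t, rfl⟩ := LinearMap.rTensor_surjective B hπAs z
    have h1 : actX A B W b₀ b₁ (πA.rTensor B t) = πA.rTensor B (actX A B M b₀ b₁ t) := by
      induction t with
      | zero => simp
      | add x y hx hy => simp only [map_add, hx, hy]
      | tmul m b => simp [actX, hπA_apply]
    have h2 : ρ ∘ₗ mapA (actY A B M b₀ b₁) = actY A B W b₀ b₁ ∘ₗ ρ := by
      refine AdicCompletion.eq_of_forall_of hBW fun t => ?_
      rw [LinearMap.comp_apply, hmapA, AdicCompletion.map_of, LinearMap.comp_apply, hρ, hρ]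
      induction t with
      | zero => simp
      | add x y hx hy => simp only [map_add, hx, hy]
      | tmul m b => simp [actY, hπA_apply]
    rw [h1, hφof, hφof, ← AdicCompletion.map_of, hlin]
    exact LinearMap.congr_fun h2 _
  · obtain ⟨m, rfl⟩ := hπ w
    obtain ⟨ε₀₁, ε₁₂, ε₀₂, h₀₁, h₁₂, h₀₂, hc⟩ := hcoc
    let σ := AdicCompletion.liftOfSMulEqZero (πA.lTensor (B ⊗[A] B)) hBB
    have hσ : ∀ t, σ (AdicCompletion.of _ _ t) = πA.lTensor (B ⊗[A] B) t := fun _ => rfl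
    have h1 : insMid A B W 1 ∘ₗ ρ = σ ∘ₗ mapA (insMid A B M 1) := by
      refine AdicCompletion.eq_of_forall_of hBB fun t => ?_
      rw [LinearMap.comp_apply, LinearMap.comp_apply, hmapA, AdicCompletion.map_of, hρ, hσ]
      induction t with
      | zero => simp
      | add x y hx hy => simp only [map_add, hx, hy]
      | tmul m b => simp [insMid]
    have h2 : ∀ b' : B, σ ∘ₗ mapA (TensorProduct.assoc A B B M).symm.toLinearMap ∘ₗ
        mapA (TensorProduct.mk A B (B ⊗[A] M) b') =
        (TensorProduct.assoc A B B W).symm.toLinearMap ∘ₗ TensorProduct.mk A B _ b' ∘ₗ ρ := by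
      intro b'
      refine AdicCompletion.eq_of_forall_of hBB fun t => ?_
      simp only [LinearMap.comp_apply, hmapA, AdicCompletion.map_of, hρ, hσ]
      induction t with
      | zero => simp
      | add x y hx hy => simp only [map_add, hx, hy]
      | tmul m b => simp
    have h3 : σ ∘ₗ mapA (TensorProduct.assoc A B B M).symm.toLinearMap ∘ₗ ε₁₂ ∘ₗ
        mapA (TensorProduct.assoc A B M B).toLinearMap ∘ₗ
        mapA (Y := (B ⊗[A] M) ⊗[A] B) ((TensorProduct.mk A (B ⊗[A] M) B).flip b) =
        (TensorProduct.assoc A B B W).symm.toLinearMap ∘ₗ φ.toLinearMap.lTensor B ∘ₗ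
        (TensorProduct.assoc A B W B).toLinearMap ∘ₗ
        (TensorProduct.mk A (B ⊗[A] W) B).flip b ∘ₗ ρ := by
      refine AdicCompletion.eq_of_forall_of hBB fun t => ?_
      simp only [LinearMap.comp_apply, hmapA, AdicCompletion.map_of, hρ]
      induction t with
      | zero => simp
      | add x y hx hy => simp only [map_add, hx, hy]
      | tmul b' m =>
        have := LinearMap.congr_fun (h2 b') (ε (AdicCompletion.of _ _ (m ⊗ₜ b)))
        simp only [LinearMap.comp_apply, hmapA] at this
        simp only [LinearMap.flip_apply, TensorProduct.mk_apply, LinearEquiv.coe_coe,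
          TensorProduct.assoc_tmul, LinearMap.lTensor_tmul, h₁₂] at this ⊢
        rw [this, ← hφtmul]
        rfl
    rw [hφtmul, hφtmul]
    have e1 := LinearMap.congr_fun h1 (ε (AdicCompletion.of _ _ (m ⊗ₜ b)))
    have e3 := LinearMap.congr_fun h3 (ε (AdicCompletion.of _ _ (m ⊗ₜ 1)))
    simp only [LinearMap.comp_apply, hmapA] at e1 e3
    rw [e1, ← h₀₂, hc, h₀₁, e3]
    rfl

end DescentDatum

lemma exists_seq_of_forall_exists_succ {α : Type*} {p : ℕ → α → Prop} {rel : ℕ → α → α → Prop}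
    {a : α} (h0 : p 0 a) (hs : ∀ k a, p k a → ∃ b, p (k + 1) b ∧ rel k a b) :
    ∃ x : ℕ → α, ∀ k, p k (x k) ∧ rel k (x k) (x (k + 1)) := by
  choose s hsp hsr using hs
  let x : ∀ k, {a // p k a} := fun k => Nat.rec ⟨a, h0⟩ (fun k a => ⟨s k a.1 a.2, hsp k a.1 a.2⟩) k
  exact ⟨fun k => (x k).1, fun k => ⟨(x k).2, hsr k (x k).1 (x k).2⟩⟩

section Limits
variable {R : Type u} [CommRing R] {r : R} {X : Type u} [AddCommGroup X] [Module R X]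

lemma exists_smul_pow_eq_of_le {m n : ℕ} (hmn : m ≤ n) {x : X} (hx : ∃ y, r ^ n • y = x) :
    ∃ y, r ^ m • y = x := by
  obtain ⟨y, rfl⟩ := hx
  exact ⟨r ^ (n - m) • y, by rw [smul_smul, ← pow_add, Nat.add_sub_cancel' hmn]⟩

lemma exists_limit_of_forall_exists_succ [IsPrecomplete (Ideal.span {r}) X] {p : ℕ → X → Prop}
    {a : X} (h0 : p 0 a) (hs : ∀ k a, p k a → ∃ b, p (k + 1) b ∧ ∃ y, r ^ k • y = b - a) :
    ∃ L, ∀ k, ∃ x, p k x ∧ ∃ y, r ^ k • y = L - x := by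
  obtain ⟨x, hx⟩ := exists_seq_of_forall_exists_succ (rel := fun k a b => ∃ y, r ^ k • y = b - a)
    h0 hs
  obtain ⟨L, hL⟩ := IsPrecomplete.prec (I := Ideal.span {r}) inferInstance (f := x) (by
    intro m n hmn
    induction n, hmn using Nat.le_induction with
    | base => exact SModEq.rfl
    | succ n hmn ih =>
      refine ih.trans (SModEq.symm ?_)
      rw [SModEq.sub_mem, mem_span_singleton_pow_smul_top]
      exact exists_smul_pow_eq_of_le hmn (hx n).2)
  refine ⟨L, fun k => ⟨x k, (hx k).1, ?_⟩⟩
  rw [← mem_span_singleton_pow_smul_top, ← SModEq.sub_mem]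
  exact (hL k).symm

lemma eq_zero_of_forall_exists_smul_pow [IsHausdorff (Ideal.span {r}) X] {x : X}
    (h : ∀ n, ∃ y, r ^ n • y = x) : x = 0 := by
  refine IsHausdorff.haus (I := Ideal.span {r}) inferInstance x fun n => ?_
  rw [SModEq.zero, mem_span_singleton_pow_smul_top]
  exact h n

lemma exists_smul_eq_apply_of_mem_ker {Y : Type u} [AddCommGroup Y] [Module R Y] {D : X →ₗ[R] Y}
    {x : X} (hx : x ∈ LinearMap.ker D) (s : R) : ∃ z, s • z = D x :=
  ⟨0, by rw [LinearMap.mem_ker.1 hx, smul_zero]⟩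

lemma mem_ker_of_forall_exists_smul {Y : Type u} [AddCommGroup Y] [Module R Y]
    [IsHausdorff (Ideal.span {r}) Y] {D : X →ₗ[R] Y} {x : X}
    (hx : ∀ k, ∃ y, (∃ z, r ^ k • z = D y) ∧ ∃ m, r ^ k • m = x - y) : x ∈ LinearMap.ker D := by
  refine eq_zero_of_forall_exists_smul_pow (r := r) fun k => ?_
  obtain ⟨y, ⟨z, hz⟩, m, hm⟩ := hx k
  exact ⟨z + D m, by rw [smul_add, hz, ← map_smul, hm, map_sub, add_sub_cancel]⟩

end Limits

section Limit
variable {A : Type u} [CommRing A] {f : A} {B : Type u} [CommRing B] [Algebra A B]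

section Restrict
variable {M W : Type u} [AddCommGroup M] [Module B M] [Module A M] [IsScalarTower A B M]
  [SMulCommClass B A M] [AddCommGroup W] [Module B W] [Module A W] [IsScalarTower A B W]
  [SMulCommClass B A W]

lemma extendSubmodule_rTensor_restrict (π : M →ₗ[B] W) {P : Submodule A M} {Q : Submodule A W}
    (h : ∀ x ∈ P, π.restrictScalars A x ∈ Q) (t : P ⊗[A] B) :
    extendSubmodule Q (((π.restrictScalars A).restrict h).rTensor B t) =
      π (extendSubmodule P t) := by
  induction t with
  | zero => simp
  | add x y hx hy => simp only [map_add, hx, hy]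
  | tmul x b => simp

lemma extendSubmodule_inclusion {P Q : Submodule A W} (h : P ≤ Q) (t : P ⊗[A] B) :
    extendSubmodule Q ((Submodule.inclusion h).rTensor B t) = extendSubmodule P t := by
  induction t with
  | zero => simp
  | add x y hx hy => simp only [map_add, hx, hy]
  | tmul x b => simp

/-- If `W` is generated by the descended submodule `Q`, then `Q ∩ f ^ k W = f ^ k Q`. -/
lemma exists_smul_eq_of_bijective_extendSubmodule (hB : IsTorsionFaithfullyFlat f B) {n : ℕ}
    (hW : ∀ w : W, f ^ n • w = 0) {Q : Submodule A W}
    (hQ : Function.Bijective (extendSubmodule (B := B) Q)) {w : W} {k : ℕ}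
    (hw : f ^ k • w ∈ Q) : ∃ v ∈ Q, f ^ k • v = f ^ k • w := by
  let K : Submodule A W := Q ⊓ LinearMap.range (LinearMap.lsmul A W (f ^ k))
  have hKW : ∀ x : K, f ^ n • x = 0 := fun x => Subtype.ext (hW x)
  have hQW : ∀ x : Q, f ^ n • x = 0 := fun x => Subtype.ext (hW x)
  have hKQ : K ≤ Q := inf_le_left
  have hinj : Function.Injective (extendSubmodule (B := B) K) := by
    have h1 : Function.Injective ((Submodule.inclusion hKQ).rTensor B) :=
      hB.rTensor_injective n _ hQW (Submodule.inclusion_injective hKQ)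
    intro x y hxy
    rw [← extendSubmodule_inclusion hKQ, ← extendSubmodule_inclusion hKQ] at hxy
    exact h1 (hQ.1 hxy)
  let e : Q →ₗ[A] K := (f ^ k • Q.subtype).codRestrict K fun x =>
    ⟨Q.smul_mem _ x.2, ⟨x, rfl⟩⟩
  have heB : ∀ s : Q ⊗[A] B, extendSubmodule K (e.rTensor B s) = f ^ k • extendSubmodule Q s := by
    intro s
    induction s with
    | zero => simp
    | add x y hx hy => simp only [map_add, smul_add, hx, hy]
    | tmul x b =>
      rw [LinearMap.rTensor_tmul, extendSubmodule_tmul, extendSubmodule_tmul]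
      exact smul_comm _ _ _
  have hdiv : ∀ t : K ⊗[A] B, ∃ v : W, f ^ k • v = extendSubmodule K t := by
    intro t
    induction t with
    | zero => exact ⟨0, by simp⟩
    | add x y hx hy =>
      obtain ⟨v, hv⟩ := hx
      obtain ⟨v', hv'⟩ := hy
      exact ⟨v + v', by rw [smul_add, hv, hv', map_add]⟩
    | tmul x b =>
      obtain ⟨v, hv⟩ := x.2.2
      refine ⟨b • v, ?_⟩
      rw [extendSubmodule_tmul, ← hv]
      exact smul_comm _ _ _
  have hes : Function.Surjective e := by
    refine hB.surjective_of_rTensor e hKW fun t => ?_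
    obtain ⟨v, hv⟩ := hdiv t
    obtain ⟨s, rfl⟩ := hQ.2 v
    exact ⟨s, hinj (by rw [heB, hv])⟩
  obtain ⟨v, hv⟩ := hes ⟨f ^ k • w, hw, ⟨w, rfl⟩⟩
  exact ⟨v, v.2, congrArg Subtype.val hv⟩

end Restrict

variable {M V : Type u} [AddCommGroup M] [Module B M] [Module A M] [IsScalarTower A B M]
  [SMulCommClass B A M] [AddCommGroup V] [Module A V]
variable {D : M →ₗ[A] V}
variable {W : ℕ → Type u} [∀ n, AddCommGroup (W n)] [∀ n, Module B (W n)] [∀ n, Module A (W n)]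
  [∀ n, IsScalarTower A B (W n)] [∀ n, SMulCommClass B A (W n)]
  {π : ∀ n, M →ₗ[B] W n} {Q : ∀ n, Submodule A (W n)}

section Lifting
variable (hB : IsTorsionFaithfullyFlat f B)
  (hW : ∀ n (w : W n), f ^ n • w = 0) (hπ : ∀ n, Function.Surjective (π n))
  (hπk : ∀ n x, π n x = 0 ↔ ∃ y, f ^ n • y = x)
  (hQ : ∀ n x, π n x ∈ Q n ↔ ∃ z, f ^ n • z = D x)
  (hQB : ∀ n, Function.Bijective (extendSubmodule (B := B) (Q n)))
include hB hW hπ hπk hQ hQB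

lemma exists_sub_of_mem_succ {n : ℕ} {x : M} (hx : π n x ∈ Q n) :
    ∃ y, π (n + 1) y ∈ Q (n + 1) ∧ ∃ m, f ^ n • m = y - x := by
  let P : Submodule A M := (Q (n + 1)).comap ((π (n + 1)).restrictScalars A)
  have hP : ∀ y ∈ P, (π (n + 1)).restrictScalars A y ∈ Q (n + 1) := fun y hy => hy
  have hP' : ∀ y ∈ P, (π n).restrictScalars A y ∈ Q n := fun y hy =>
    (hQ n y).2 (exists_smul_pow_eq_of_le n.le_succ ((hQ (n + 1) y).1 hy))
  have hqs : Function.Surjective (((π (n + 1)).restrictScalars A).restrict hP) := by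
    rintro ⟨w, hw⟩
    obtain ⟨y, rfl⟩ := hπ (n + 1) w
    exact ⟨⟨y, hw⟩, rfl⟩
  have hs : Function.Surjective (((π n).restrictScalars A).restrict hP') := by
    refine hB.surjective_of_rTensor (n := n) _ (fun y => Subtype.ext (hW n y)) fun t => ?_
    obtain ⟨m, hm⟩ := hπ n (extendSubmodule (Q n) t)
    obtain ⟨s, hs⟩ := (hQB (n + 1)).2 (π (n + 1) m)
    obtain ⟨s, rfl⟩ := LinearMap.rTensor_surjective B hqs s
    refine ⟨s, (hQB n).1 ?_⟩
    rw [extendSubmodule_rTensor_restrict] at hs ⊢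
    rw [← hm, ← sub_eq_zero, ← map_sub, hπk]
    rw [← sub_eq_zero, ← map_sub, hπk] at hs
    exact exists_smul_pow_eq_of_le n.le_succ hs
  obtain ⟨y, hy⟩ := hs ⟨π n x, hx⟩
  refine ⟨y, y.2, ?_⟩
  rw [← hπk, map_sub, sub_eq_zero]
  exact congrArg Subtype.val hy

variable [IsHausdorff (Ideal.span {f}) V] [IsPrecomplete (Ideal.span {f}) M]

lemma exists_mem_ker_sub {n : ℕ} {x : M} (hx : π n x ∈ Q n) :
    ∃ y ∈ LinearMap.ker D, ∃ m, f ^ n • m = y - x := by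
  obtain ⟨L, hL⟩ := exists_limit_of_forall_exists_succ (r := f)
    (p := fun k b => π (n + k) b ∈ Q (n + k) ∧ ∃ m, f ^ n • m = b - x) (a := x)
    ⟨hx, 0, by simp⟩ (by
      rintro k a ⟨ha, m, hm⟩
      obtain ⟨b, hb, m', hm'⟩ := exists_sub_of_mem_succ hB hW hπ hπk hQ hQB ha
      refine ⟨b, ⟨hb, m + f ^ k • m', ?_⟩, f ^ n • m', ?_⟩
      · rw [smul_add, hm, smul_smul, ← pow_add, hm']; abel
      · rw [smul_smul, ← pow_add, add_comm k n, hm'])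
  refine ⟨L, mem_ker_of_forall_exists_smul (r := f) fun k => ?_, ?_⟩
  · obtain ⟨y, ⟨hy, -⟩, hy'⟩ := hL k
    exact ⟨y, exists_smul_pow_eq_of_le (Nat.le_add_left k n) ((hQ _ y).1 hy), hy'⟩
  · obtain ⟨y, ⟨-, m, hm⟩, m', hm'⟩ := hL n
    exact ⟨m + m', by rw [smul_add, hm, hm']; abel⟩


lemma surjective_restrict_ker (n : ℕ)
    (hmem : ∀ y ∈ LinearMap.ker D, (π n).restrictScalars A y ∈ Q n) :
    Function.Surjective (((π n).restrictScalars A).restrict hmem) := by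
  rintro ⟨w, hw⟩
  obtain ⟨y, rfl⟩ := hπ n w
  obtain ⟨z, hz, hzy⟩ := exists_mem_ker_sub hB hW hπ hπk hQ hQB hw
  refine ⟨⟨z, hz⟩, Subtype.ext ?_⟩
  rw [← hπk, map_sub, sub_eq_zero] at hzy
  exact hzy

lemma exists_smul_eq_sub_extendSubmodule (n : ℕ) (m : M) :
    ∃ t : LinearMap.ker D ⊗[A] B, ∃ y, f ^ n • y = m - extendSubmodule (LinearMap.ker D) t := by
  have hmem : ∀ y ∈ LinearMap.ker D, (π n).restrictScalars A y ∈ Q n := fun y hy =>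
    (hQ n y).2 (exists_smul_eq_apply_of_mem_ker hy _)
  have hqs := surjective_restrict_ker hB hW hπ hπk hQ hQB n hmem
  obtain ⟨s, hs⟩ := (hQB n).2 (π n m)
  obtain ⟨t, rfl⟩ := LinearMap.rTensor_surjective B hqs s
  refine ⟨t, ?_⟩
  rw [extendSubmodule_rTensor_restrict] at hs
  rw [← hπk, map_sub, hs, sub_self]

variable [IsHausdorff (Ideal.span {f}) M]

lemma exists_mem_ker_smul_eq {n : ℕ} {x : M} (hx : x ∈ LinearMap.ker D)
    (hxn : ∃ m, f ^ n • m = x) : ∃ y ∈ LinearMap.ker D, f ^ n • y = x := by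
  have hstep : ∀ k, ∀ y ∈ LinearMap.ker D, (∃ m, f ^ k • m = y) →
      ∃ z ∈ LinearMap.ker D, ∃ m, f ^ (k + 1) • m = y - f ^ k • z := by
    rintro k y hy ⟨m, rfl⟩
    have h1 := (hQ (k + 1) _).2 (exists_smul_eq_apply_of_mem_ker hy _)
    rw [← LinearMap.coe_restrictScalars A, map_smul, LinearMap.coe_restrictScalars] at h1
    obtain ⟨w, hw, hwm⟩ := exists_smul_eq_of_bijective_extendSubmodule hB (hW _) (hQB _) h1
    obtain ⟨w, rfl⟩ := hπ _ w
    obtain ⟨z, hz, m', hm'⟩ := exists_mem_ker_sub hB hW hπ hπk hQ hQB hw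
    refine ⟨z, hz, (hπk _ _).1 ?_⟩
    rw [← LinearMap.coe_restrictScalars A] at hwm ⊢
    have h2 : (π (k + 1)).restrictScalars A (z - w) = 0 := (hπk _ _).2 ⟨m', hm'⟩
    rw [map_sub, sub_eq_zero] at h2
    rw [map_sub, map_smul, map_smul, h2, hwm, sub_self]
  obtain ⟨L, hL⟩ := exists_limit_of_forall_exists_succ (r := f)
    (p := fun k b => b ∈ LinearMap.ker D ∧ ∃ m, f ^ (n + k) • m = x - f ^ n • b) (a := 0)
    ⟨zero_mem _, by simpa using hxn⟩ (by
      rintro k a ⟨ha, hm⟩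
      obtain ⟨z, hz, m', hm'⟩ := hstep (n + k) _
        (sub_mem hx (Submodule.smul_mem _ (f ^ n) ha)) hm
      refine ⟨a + f ^ k • z, ⟨add_mem ha (Submodule.smul_mem _ _ hz), m', ?_⟩, z, by simp⟩
      rw [← add_assoc, hm', smul_add, smul_smul, ← pow_add]; abel)
  refine ⟨L, mem_ker_of_forall_exists_smul (r := f) fun k => ?_, ?_⟩
  · obtain ⟨y, ⟨hy, -⟩, hy'⟩ := hL k
    exact ⟨y, exists_smul_eq_apply_of_mem_ker hy _, hy'⟩
  · rw [← sub_eq_zero]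
    refine eq_zero_of_forall_exists_smul_pow (r := f) fun k => ?_
    obtain ⟨y, ⟨-, m, hm⟩, m', hm'⟩ := hL k
    refine ⟨f ^ n • (m' - m), ?_⟩
    have : f ^ n • L = f ^ n • (L - y) + f ^ n • y := by rw [← smul_add, sub_add_cancel]
    rw [this, ← hm', smul_comm (f ^ k), smul_sub, smul_sub, smul_smul _ _ m, ← pow_add, hm]
    abel

lemma isAdicComplete_ker : IsAdicComplete (Ideal.span {f}) (LinearMap.ker D) := by
  have hh : IsHausdorff (Ideal.span {f}) (LinearMap.ker D) := ⟨fun x hx => by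
    refine Subtype.ext (eq_zero_of_forall_exists_smul_pow (r := f) fun n => ?_)
    obtain ⟨y, hy⟩ := mem_span_singleton_pow_smul_top.1 (SModEq.zero.1 (hx n))
    exact ⟨y, congrArg Subtype.val hy⟩⟩
  have hp : IsPrecomplete (Ideal.span {f}) (LinearMap.ker D) := ⟨fun x hx => by
    obtain ⟨L, hL⟩ := IsPrecomplete.prec (I := Ideal.span {f}) (M := M) inferInstance
      (f := fun n => (x n : M)) (by
        intro m n hmn
        rw [SModEq.sub_mem, mem_span_singleton_pow_smul_top]
        obtain ⟨y, hy⟩ := mem_span_singleton_pow_smul_top.1 (SModEq.sub_mem.1 (hx hmn))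
        exact ⟨y, congrArg Subtype.val hy⟩)
    have hL' : ∀ n, ∃ y, f ^ n • y = L - x n := fun n =>
      mem_span_singleton_pow_smul_top.1 (SModEq.sub_mem.1 (hL n).symm)
    have hLm : L ∈ LinearMap.ker D := mem_ker_of_forall_exists_smul (r := f) fun k =>
      ⟨x k, exists_smul_eq_apply_of_mem_ker (x k).2 _, hL' k⟩
    refine ⟨⟨L, hLm⟩, fun n => SModEq.symm ?_⟩
    obtain ⟨y, hy, hyn⟩ := exists_mem_ker_smul_eq hB hW hπ hπk hQ hQB
      (sub_mem hLm (x n).2) (hL' n)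
    rw [SModEq.sub_mem, mem_span_singleton_pow_smul_top]
    exact ⟨⟨y, hy⟩, Subtype.ext hyn⟩⟩
  constructor

lemma exists_smul_eq_of_extendSubmodule_eq (n : ℕ) (t : LinearMap.ker D ⊗[A] B)
    (ht : ∃ y, f ^ n • y = extendSubmodule (LinearMap.ker D) t) : ∃ s, f ^ n • s = t := by
  have hmem : ∀ y ∈ LinearMap.ker D, (π n).restrictScalars A y ∈ Q n := fun y hy =>
    (hQ n y).2 (exists_smul_eq_apply_of_mem_ker hy _)
  have hqs := surjective_restrict_ker hB hW hπ hπk hQ hQB n hmem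
  refine exists_smul_of_rTensor_eq_zero hqs (fun x => ?_) t ((hQB n).1 ?_)
  · have h1 : ((π n).restrictScalars A).restrict hmem x = 0 ↔ π n x = 0 :=
      Subtype.ext_iff
    rw [h1, hπk]
    constructor
    · intro hx
      obtain ⟨y, hy, hyx⟩ := exists_mem_ker_smul_eq hB hW hπ hπk hQ hQB x.2 hx
      exact ⟨⟨y, hy⟩, Subtype.ext hyx⟩
    · rintro ⟨y, rfl⟩
      exact ⟨y, rfl⟩
  · rw [extendSubmodule_rTensor_restrict, map_zero, hπk]
    exact ht

end Lifting
end Limit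

section Effectivity
variable {A : Type u} [CommRing A] {f : A} {B : Type u} [CommRing B] [Algebra A B]

lemma lTensor_injective_of_mod_pow {P Q X : Type u} [AddCommGroup P] [Module A P]
    [AddCommGroup Q] [Module A Q] [AddCommGroup X] [Module A X] {n : ℕ}
    (hX : ∀ x : X, f ^ n • x = 0) {β : P →ₗ[A] Q}
    (hs : ∀ q, ∃ p y, f ^ n • y = q - β p)
    (hi : ∀ p, (∃ y, f ^ n • y = β p) → ∃ s, f ^ n • s = p) :
    Function.Injective (β.lTensor X) := by
  let U : Submodule A Q := LinearMap.range (LinearMap.lsmul A Q (f ^ n))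
  have hU : ∀ q, U.mkQ q = 0 ↔ ∃ y, f ^ n • y = q := fun q => Submodule.Quotient.mk_eq_zero U
  have hsurj : Function.Surjective (U.mkQ ∘ₗ β) := fun w => by
    obtain ⟨q, rfl⟩ := U.mkQ_surjective w
    obtain ⟨p, hp⟩ := hs q
    refine ⟨p, ?_⟩
    rw [← hU, map_sub, sub_eq_zero] at hp
    exact hp.symm
  rw [injective_iff_map_eq_zero]
  intro t ht
  obtain ⟨s, rfl⟩ := exists_smul_of_lTensor_eq_zero (r := f) (n := n) hsurj (fun p => by
    rw [LinearMap.comp_apply, hU]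
    refine ⟨hi p, ?_⟩
    rintro ⟨s, rfl⟩
    exact ⟨β s, (map_smul _ _ _).symm⟩) t (by
      rw [LinearMap.lTensor_comp, LinearMap.comp_apply, ht, map_zero])
  exact smul_tensor_eq_zero_left hX s

lemma rTensor_injective_of_flat_mod_pow (hB : IsTorsionFaithfullyFlat f B)
    {M : Type u} [AddCommGroup M] [Module B M] [Module A M] [IsScalarTower A B M]
    [SMulCommClass B A M] {n : ℕ}
    (hM : Module.Flat (B ⧸ (Ideal.span {algebraMap A B f} ^ n))
      ((B ⧸ (Ideal.span {algebraMap A B f} ^ n)) ⊗[B] M))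
    {X Y : Type u} [AddCommGroup X] [Module A X] [AddCommGroup Y] [Module A Y]
    (u : X →ₗ[A] Y) (hY : ∀ y : Y, f ^ n • y = 0) (hu : Function.Injective u) :
    Function.Injective (u.rTensor M) := by
  rw [← LinearMap.lTensor_inj_iff_rTensor_inj]
  have h1 : Function.Injective (u.baseChange B) := by
    change Function.Injective (u.lTensor B)
    rw [LinearMap.lTensor_inj_iff_rTensor_inj]
    exact hB.rTensor_injective n u hY hu
  have htors : Module.IsTorsionBySet B (B ⊗[A] Y) (Ideal.span {algebraMap A B f} ^ n : Ideal B) := by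
    rw [Ideal.span_singleton_pow]
    refine isTorsionBySet_span_of_smul_eq_zero fun z => ?_
    rw [← map_pow, algebraMap_smul]
    exact smul_tensor_eq_zero_right hY z
  have h2 := (flat_quotient_tensor_iff _ M).1 hM _ _ (u.baseChange B) htors h1
  rw [← LinearMap.lTensor_inj_iff_rTensor_inj] at h2
  have hc : ∀ t : M ⊗[B] (B ⊗[A] X), AlgebraTensorModule.cancelBaseChange A B B M Y
      ((u.baseChange B).lTensor M t) =
        u.lTensor M (AlgebraTensorModule.cancelBaseChange A B B M X t) := by
    intro t
    induction t with
    | zero => simp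
    | add x y hx hy => simp only [map_add, hx, hy]
    | tmul m s =>
      induction s with
      | zero => simp
      | add x y hx hy => simp only [map_add, tmul_add, hx, hy]
      | tmul b x => simp
  intro x y hxy
  obtain ⟨x, rfl⟩ := (AlgebraTensorModule.cancelBaseChange A B B M X).surjective x
  obtain ⟨y, rfl⟩ := (AlgebraTensorModule.cancelBaseChange A B B M X).surjective y
  rw [← hc, ← hc] at hxy
  rw [h2 ((AlgebraTensorModule.cancelBaseChange A B B M Y).injective hxy)]

lemma flat_mod_pow_of_tensor_mod_pow (hB : IsTorsionFaithfullyFlat f B)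
    {M : Type u} [AddCommGroup M] [Module B M] [Module A M] [IsScalarTower A B M]
    [SMulCommClass B A M] {n : ℕ}
    (hM : Module.Flat (B ⧸ (Ideal.span {algebraMap A B f} ^ n))
      ((B ⧸ (Ideal.span {algebraMap A B f} ^ n)) ⊗[B] M))
    {N : Type u} [AddCommGroup N] [Module A N] {β : N ⊗[A] B →ₗ[A] M}
    (hs : ∀ m, ∃ t y, f ^ n • y = m - β t)
    (hi : ∀ t, (∃ y, f ^ n • y = β t) → ∃ s, f ^ n • s = t) :
    Module.Flat (A ⧸ (Ideal.span {f} ^ n)) ((A ⧸ (Ideal.span {f} ^ n)) ⊗[A] N) := by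
  refine (flat_quotient_tensor_iff _ N).2 fun X Y _ _ _ _ u htors hu => ?_
  have hY : ∀ y : Y, f ^ n • y = 0 := fun y => @htors y
    ⟨f ^ n, Ideal.pow_mem_pow (Ideal.mem_span_singleton_self f) n⟩
  have hX : ∀ x : X, f ^ n • x = 0 := fun x => hu (by rw [map_smul, hY, map_zero])
  refine hB.injective_of_rTensor (n := n) _ (smul_tensor_eq_zero_left hX) ?_
  have h1 : Function.Injective (u.rTensor (N ⊗[A] B)) := by
    refine Function.Injective.of_comp (f := β.lTensor Y) ?_
    rw [← LinearMap.coe_comp, LinearMap.lTensor_comp_rTensor, ← LinearMap.rTensor_comp_lTensor,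
      LinearMap.coe_comp]
    exact (rTensor_injective_of_flat_mod_pow hB hM u hY hu).comp
      (lTensor_injective_of_mod_pow hX hs hi)
  rw [LinearMap.rTensor_tensor] at h1
  simpa using h1

lemma AdicCompletion.map_bijective_of_mod_pow {P Q : Type u} [AddCommGroup P] [Module A P]
    [AddCommGroup Q] [Module A Q] {β : P →ₗ[A] Q}
    (hs : ∀ (n : ℕ) q, ∃ p y, f ^ n • y = q - β p)
    (hi : ∀ (n : ℕ) p, (∃ y, f ^ n • y = β p) → ∃ s, f ^ n • s = p) :
    Function.Bijective (AdicCompletion.map (Ideal.span {f}) β) := by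
  constructor
  · rw [injective_iff_map_eq_zero]
    intro z hz
    refine eq_zero_of_forall_exists_smul_pow (r := f) fun n => ?_
    obtain ⟨p, z', rfl⟩ := AdicCompletion.exists_eq_of_add_smul n z
    have h1 : AdicCompletion.of (Ideal.span {f}) Q (β p) =
        f ^ n • -AdicCompletion.map (Ideal.span {f}) β z' := by
      rw [map_add, AdicCompletion.map_of, LinearMap.map_smul_of_tower] at hz
      rw [smul_neg, eq_neg_iff_add_eq_zero, hz]
    have h2 : AdicCompletion.eval (Ideal.span {f}) Q n (AdicCompletion.of _ Q (β p)) = 0 := by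
      rw [← LinearMap.mem_ker, ← AdicCompletion.pow_smul_top_eq_ker_eval ⟨{f}, by simp⟩,
        mem_span_singleton_pow_smul_top]
      exact ⟨_, h1.symm⟩
    rw [AdicCompletion.eval_of, Submodule.mkQ_apply, Submodule.Quotient.mk_eq_zero,
      mem_span_singleton_pow_smul_top] at h2
    obtain ⟨s, rfl⟩ := hi n p h2
    exact ⟨AdicCompletion.of _ P s + z', by rw [smul_add, map_smul]⟩
  · refine AdicCompletion.map_surjective_of_mkQ_comp_surjective fun w => ?_
    obtain ⟨q, rfl⟩ := Submodule.mkQ_surjective _ w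
    obtain ⟨p, y, hy⟩ := hs 1 q
    refine ⟨p, ?_⟩
    rw [eq_comm, ← sub_eq_zero, LinearMap.comp_apply, ← map_sub, Submodule.mkQ_apply,
      Submodule.Quotient.mk_eq_zero, ← pow_one (Ideal.span {f}), mem_span_singleton_pow_smul_top]
    exact ⟨y, hy⟩

end Effectivity

/-- fpqc descent for `f`-adically complete, completely flat modules along a
`(f)`-completely faithfully flat map. Let `(A,(f))` be of reduced prismatic type and `B` a
derived `f`-complete, `(f)`-completely faithfully flat `A`-algebra. Let `M` be a `B`-module,
`f`-adically complete with `M/f^nM` flat over `B/f^nB` for all `n ≥ 1`, equipped with a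
descent datum: an isomorphism `ε : (M ⊗_A B)^∧ ≅ (B ⊗_A M)^∧` of modules over
`C = (B ⊗_A B)^∧` (the source and target being the completed base changes of `M` along
`δ¹₀ : b ↦ 1 ⊗ b` resp. `δ¹₁ : b ↦ b ⊗ 1`), whose base change along the multiplication
`μ : C → B` is the identity of `M` and which satisfies the cocycle condition among the
completed base changes to `D = (B ⊗_A B ⊗_A B)^∧` (expressed in the classical concrete form
`ε₀₂ = ε₁₂ ∘ ε₀₁` on the completions of the threefold tensor products). Then the descent
datum is effective: there is an `f`-adically complete `A`-module `N` with `N/f^nN` flat over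
`A/f^nA` for all `n ≥ 1` and an isomorphism of `B`-modules `(N ⊗_A B)^∧ ≅ M` under which `ε`
corresponds to the canonical descent datum of `N` (induced by the identity of `N`, permuting
the `B`-factors). -/
theorem descent_effective_for_complete_flat
    (hder : DerivedComplete A f A)
    (hbdd : ∃ c : ℕ, ∀ x : A, (∃ n : ℕ, f ^ n * x = 0) → f ^ c * x = 0)
    (hBder : DerivedComplete A f B)
    (hBTor : TorVanish A B (A ⧸ Ideal.span {f}))
    (hBff : Module.FaithfullyFlat (A ⧸ Ideal.span {f}) ((A ⧸ Ideal.span {f}) ⊗[A] B))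
    (hMc : IsAdicComplete (Ideal.span {f} : Ideal A) M)
    (hMflat : ∀ n : ℕ, 1 ≤ n →
      Module.Flat (B ⧸ (Ideal.span {algebraMap A B f} ^ n))
        ((B ⧸ (Ideal.span {algebraMap A B f} ^ n)) ⊗[B] M))
    (ε : AdicCompletion (Ideal.span {f}) (M ⊗[A] B) ≃ₗ[A]
      AdicCompletion (Ideal.span {f}) (B ⊗[A] M))
    -- `ε` is `C`-linear: it intertwines the actions of `b₀ ⊗ b₁ ∈ B ⊗[A] B`
    (hlin : ∀ (b₀ b₁ : B) (z : AdicCompletion (Ideal.span {f}) (M ⊗[A] B)),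
      ε (AdicCompletion.map (Ideal.span {f}) (actX A B M b₀ b₁) z) =
        AdicCompletion.map (Ideal.span {f}) (actY A B M b₀ b₁) (ε z))
    -- the base change of `ε` along `μ : C → B` is the identity of `M`
    (hmu : ∀ x : M ⊗[A] B,
      AdicCompletion.map (Ideal.span {f}) (collapseY A B M)
          (ε (AdicCompletion.of (Ideal.span {f}) (M ⊗[A] B) x)) =
        AdicCompletion.of (Ideal.span {f}) M (collapseX A B M x))
    -- the cocycle condition `δ²₁*(ε) = δ²₂*(ε) ∘ δ²₀*(ε)`, in the classical concrete form
    -- `ε₀₂ = ε₁₂ ∘ ε₀₁` on the completed threefold tensor products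
    (hcoc : ∃ (ε₀₁ : AdicCompletion (Ideal.span {f}) ((M ⊗[A] B) ⊗[A] B) →ₗ[A]
          AdicCompletion (Ideal.span {f}) ((B ⊗[A] M) ⊗[A] B))
        (ε₁₂ : AdicCompletion (Ideal.span {f}) (B ⊗[A] (M ⊗[A] B)) →ₗ[A]
          AdicCompletion (Ideal.span {f}) (B ⊗[A] (B ⊗[A] M)))
        (ε₀₂ : AdicCompletion (Ideal.span {f}) ((M ⊗[A] B) ⊗[A] B) →ₗ[A]
          AdicCompletion (Ideal.span {f}) ((B ⊗[A] B) ⊗[A] M)),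
      (∀ (x : M ⊗[A] B) (b : B),
        ε₀₁ (AdicCompletion.of (Ideal.span {f}) ((M ⊗[A] B) ⊗[A] B) (x ⊗ₜ[A] b)) =
          AdicCompletion.map (Ideal.span {f}) ((TensorProduct.mk A (B ⊗[A] M) B).flip b)
            (ε (AdicCompletion.of (Ideal.span {f}) (M ⊗[A] B) x))) ∧
      (∀ (b : B) (x : M ⊗[A] B),
        ε₁₂ (AdicCompletion.of (Ideal.span {f}) (B ⊗[A] (M ⊗[A] B)) (b ⊗ₜ[A] x)) =
          AdicCompletion.map (Ideal.span {f}) (TensorProduct.mk A B (B ⊗[A] M) b)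
            (ε (AdicCompletion.of (Ideal.span {f}) (M ⊗[A] B) x))) ∧
      (∀ (m : M) (b₁ b₂ : B),
        ε₀₂ (AdicCompletion.of (Ideal.span {f}) ((M ⊗[A] B) ⊗[A] B)
            ((m ⊗ₜ[A] b₁) ⊗ₜ[A] b₂)) =
          AdicCompletion.map (Ideal.span {f}) (insMid A B M b₁)
            (ε (AdicCompletion.of (Ideal.span {f}) (M ⊗[A] B) (m ⊗ₜ[A] b₂)))) ∧
      (∀ z : AdicCompletion (Ideal.span {f}) ((M ⊗[A] B) ⊗[A] B),
        ε₀₂ z =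
          AdicCompletion.map (Ideal.span {f}) ((TensorProduct.assoc A B B M).symm.toLinearMap)
            (ε₁₂ (AdicCompletion.map (Ideal.span {f})
              ((TensorProduct.assoc A B M B).toLinearMap) (ε₀₁ z))))) :
    -- the descent datum is effective
    ∃ N : ModuleCat.{u} A,
      IsAdicComplete (Ideal.span {f}) N ∧
      (∀ n : ℕ, 1 ≤ n →
        Module.Flat (A ⧸ (Ideal.span {f} ^ n)) ((A ⧸ (Ideal.span {f} ^ n)) ⊗[A] N)) ∧
      ∃ g : AdicCompletion (Ideal.span {f}) (N ⊗[A] B) ≃ₗ[A] M,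
        -- `g` is an isomorphism of `B`-modules
        (∀ (b : B) (z : AdicCompletion (Ideal.span {f}) (N ⊗[A] B)),
          g (AdicCompletion.map (Ideal.span {f})
              (LinearMap.lTensor (N : Type u) (LinearMap.mulLeft A b)) z) = b • g z) ∧
        -- under `g`, `ε` corresponds to the canonical descent datum of `N`,
        -- `(n ⊗ β) ⊗ b ↦ β ⊗ (n ⊗ b)` (induced by the identity of `N`)
        (∀ (n : (N : Type u)) (β b : B),
          ε (AdicCompletion.of (Ideal.span {f}) (M ⊗[A] B)
              ((g (AdicCompletion.of (Ideal.span {f}) (N ⊗[A] B) (n ⊗ₜ[A] β))) ⊗ₜ[A] b)) =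
            AdicCompletion.of (Ideal.span {f}) (B ⊗[A] M)
              (β ⊗ₜ[A] (g (AdicCompletion.of (Ideal.span {f}) (N ⊗[A] B) (n ⊗ₜ[A] b))))) := by
  have hB : IsTorsionFaithfullyFlat f B := .of_torVanish hBTor hBff
  let U (n : ℕ) : Submodule B M := LinearMap.range (f ^ n • (LinearMap.id : M →ₗ[B] M))
  have hπ (n : ℕ) : Function.Surjective (U n).mkQ := (U n).mkQ_surjective
  have hπk (n : ℕ) (x : M) : (U n).mkQ x = 0 ↔ ∃ y, f ^ n • y = x :=
    Submodule.Quotient.mk_eq_zero (U n)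
  have hW (n : ℕ) (w : M ⧸ U n) : f ^ n • w = 0 := by
    obtain ⟨x, rfl⟩ := hπ n w
    exact (hπk n _).2 ⟨x, rfl⟩
  choose φ hφ hφlin hφcoc using fun n =>
    exists_descentDatum_mod_pow hlin hcoc (hW n) (U n).mkQ (hπ n) (hπk n)
  let Q (n : ℕ) : Submodule A (M ⧸ U n) := descentInvariants (φ n).toLinearMap
  have hQB (n : ℕ) : Function.Bijective (extendSubmodule (B := B) (Q n)) :=
    bijective_extendSubmodule_descentInvariants hB (hW n) (φ n) (hφlin n) (hφcoc n)
  have hQ (n : ℕ) (x : M) : (U n).mkQ x ∈ Q n ↔ ∃ z, f ^ n • z = descentDefect ε x := by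
    rw [← AdicCompletion.liftOfSMulEqZero_eq_zero_iff (smul_tensor_eq_zero_right (hW n))
      (exists_smul_of_lTensor_eq_zero (p := (U n).mkQ.restrictScalars A) (hπ n) (hπk n)),
      descentDefect_apply, map_sub, sub_eq_zero, ← hφ]
    exact mem_descentInvariants
  let N : Submodule A M := LinearMap.ker (descentDefect ε)
  let β : N ⊗[A] B →ₗ[A] M := extendSubmodule N
  have hs (n : ℕ) (m : M) : ∃ t y, f ^ n • y = m - β t :=
    exists_smul_eq_sub_extendSubmodule hB hW hπ hπk hQ hQB n m
  have hi (n : ℕ) (t : N ⊗[A] B) : (∃ y, f ^ n • y = β t) → ∃ s, f ^ n • s = t :=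
    exists_smul_eq_of_extendSubmodule_eq hB hW hπ hπk hQ hQB n t
  let g : AdicCompletion (Ideal.span {f}) (N ⊗[A] B) ≃ₗ[A] M :=
    LinearEquiv.ofBijective ((AdicCompletion.map (Ideal.span {f}) β).restrictScalars A)
      (AdicCompletion.map_bijective_of_mod_pow hs hi) ≪≫ₗ
    (AdicCompletion.ofLinearEquiv (Ideal.span {f}) M).symm
  have hg (z) : AdicCompletion.of (Ideal.span {f}) M (g z) =
      AdicCompletion.map (Ideal.span {f}) β z :=
    (AdicCompletion.ofLinearEquiv (Ideal.span {f}) M).apply_symm_apply _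
  have hofinj : Function.Injective (AdicCompletion.of (Ideal.span {f}) M) :=
    (AdicCompletion.of_bijective (Ideal.span {f}) M).1
  have hgof (t : N ⊗[A] B) : g (AdicCompletion.of (Ideal.span {f}) (N ⊗[A] B) t) = β t :=
    hofinj (by rw [hg, AdicCompletion.map_of])
  refine ⟨ModuleCat.of A N, isAdicComplete_ker hB hW hπ hπk hQ hQB,
    fun n hn => flat_mod_pow_of_tensor_mod_pow hB (hMflat n hn) (hs n) (hi n), g,
    fun b z => hofinj ?_, fun n β' b => ?_⟩
  · have h1 : β ∘ₗ LinearMap.lTensor N (LinearMap.mulLeft A b) = Algebra.lsmul A A M b ∘ₗ β := by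
      refine TensorProduct.ext' fun n b' => ?_
      simp [β, mul_smul]
    have h2 := AdicCompletion.map_of (Ideal.span {f}) (Algebra.lsmul A A M b) (g z)
    rw [hg, AdicCompletion.map_comp_apply, ← h1, ← AdicCompletion.map_comp_apply] at h2
    exact (hg _).trans h2
  · have h1 := apply_of_tmul_of_mem_ker_descentDefect hlin n.2 β' b
    have h2 (c : B) : g (AdicCompletion.of (Ideal.span {f}) (N ⊗[A] B) (n ⊗ₜ c)) = c • (n : M) :=
      (hgof _).trans (extendSubmodule_tmul N n c)
    exact (congrArg (fun x => ε (AdicCompletion.of _ _ (x ⊗ₜ[A] b))) (h2 β')).trans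
      (h1.trans (congrArg (fun x => AdicCompletion.of _ _ (β' ⊗ₜ[A] x)) (h2 b)).symm)
end

section
/- Let A be a commutative ring, J ⊆ A a finitely generated ideal, and B an A-algebra such that Tor_i^A(B, A/J) = 0 for all i ≥ 1 and B/JB is faithfully flat over A/J. Then for any A-module M the following are equivalent: (i) Tor_i^A(M, A/J) = 0 for all i ≥ 1 and M/JM is flat over A/J; (ii) Tor_i^A(M, B/JB) = 0 for all i ≥ 1 and M ⊗_A (B/JB) is flat over B/JB. -/
set_option synthInstance.maxHeartbeats 400000

open TensorProduct CategoryTheory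

universe u

open CategoryTheory.Limits

section LeftDerived

universe v₁ v₂ u₁ u₂

variable {C : Type u₁} [Category.{v₁} C] [Abelian C] [HasProjectiveResolutions C]
  {D : Type u₂} [Category.{v₂} D] [Abelian D]

/-- The higher left derived functors of an exact functor vanish. -/
lemma isZero_leftDerived_succ_of_preservesHomology (F : C ⥤ D) [F.Additive]
    [F.PreservesHomology] (X : C) (n : ℕ) : IsZero ((F.leftDerived (n + 1)).obj X) := by
  let P := projectiveResolution X
  have h : ((P.complex.sc (n + 1)).map F).Exact := (P.complex_exactAt_succ n).map F
  have h' : ((F.mapHomologicalComplex (ComplexShape.down ℕ)).obj P.complex).ExactAt (n + 1) := h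
  exact (P.isoLeftDerivedObj F (n + 1)).isZero_iff.2 h'.isZero_homology

/-- The short complex of chain complexes obtained by evaluating two composable transformations of
additive functors on a projective resolution. -/
noncomputable def resolutionShortComplex {F G H : C ⥤ D} [F.Additive] [G.Additive] [H.Additive]
    (α : F ⟶ G) (β : G ⟶ H) (w : α ≫ β = 0) {X : C} (P : ProjectiveResolution X) :
    ShortComplex (ChainComplex D ℕ) :=
  ShortComplex.mk ((NatTrans.mapHomologicalComplex α (ComplexShape.down ℕ)).app P.complex)
    ((NatTrans.mapHomologicalComplex β (ComplexShape.down ℕ)).app P.complex) (by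
      ext n
      exact congr_app w (P.complex.X n))

variable {F G H : C ⥤ D} [F.Additive] [G.Additive] [H.Additive] (α : F ⟶ G) (β : G ⟶ H)
  (w : α ≫ β = 0)
  (hex : ∀ (Y : C) [Projective Y], (ShortComplex.mk (α.app Y) (β.app Y) (congr_app w Y)).ShortExact)

include hex in
omit [HasProjectiveResolutions C] in
lemma resolutionShortComplex_shortExact {X : C} (P : ProjectiveResolution X) :
    (resolutionShortComplex α β w P).ShortExact :=
  HomologicalComplex.shortExact_of_degreewise_shortExact _ fun n => hex (P.complex.X n)

include hex in
/-- Dimension shifting for left derived functors, with respect to the functor. -/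
lemma isZero_leftDerived_add_two_iff (X : C)
    (hG : ∀ n : ℕ, IsZero ((G.leftDerived (n + 1)).obj X)) (n : ℕ) :
    IsZero ((H.leftDerived (n + 2)).obj X) ↔ IsZero ((F.leftDerived (n + 1)).obj X) := by
  let P := projectiveResolution X
  have hS := resolutionShortComplex_shortExact α β w hex P
  have hG' (k : ℕ) : IsZero ((resolutionShortComplex α β w P).X₂.homology (k + 1)) :=
    (P.isoLeftDerivedObj G (k + 1)).isZero_iff.1 (hG k)
  exact (P.isoLeftDerivedObj H (n + 2)).isZero_iff.trans
    ((hS.δIso (n + 2) (n + 1) rfl (hG' (n + 1)) (hG' n)).isZero_iff.trans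
      (P.isoLeftDerivedObj F (n + 1)).isZero_iff.symm)

include hex in
lemma isZero_leftDerived_one_iff [PreservesFiniteColimits F] [PreservesFiniteColimits G] (X : C)
    (hG : IsZero ((G.leftDerived 1).obj X)) :
    IsZero ((H.leftDerived 1).obj X) ↔ Mono (α.app X) := by
  let P := projectiveResolution X
  have hS := resolutionShortComplex_shortExact α β w hex P
  have hG' : IsZero ((resolutionShortComplex α β w P).X₂.homology 1) :=
    (P.isoLeftDerivedObj G 1).isZero_iff.1 hG
  let φ := (NatTrans.mapHomologicalComplex α (ComplexShape.down ℕ)).app P.complex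
  have hδ : IsZero ((resolutionShortComplex α β w P).X₃.homology 1) ↔
      Mono (HomologicalComplex.homologyMap φ 0) := by
    have := hS.mono_δ 1 0 rfl hG'
    have h := hS.homology_exact₁ 1 0 rfl
    refine ⟨fun hz => h.mono_g (hz.eq_of_src _ _), fun hm => ?_⟩
    have : Mono (HomologicalComplex.homologyMap (resolutionShortComplex α β w P).f 0) := hm
    exact IsZero.of_mono_eq_zero _ (zero_of_comp_mono _ (hS.δ_comp 1 0 rfl))
  have h₁ : HomologicalComplex.homologyMap φ 0 ≫ (ChainComplex.isoHomologyι₀ _).hom =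
      (ChainComplex.isoHomologyι₀ _).hom ≫ HomologicalComplex.opcyclesMap φ 0 :=
    HomologicalComplex.homologyι_naturality φ 0
  have h₂ : HomologicalComplex.opcyclesMap φ 0 ≫ P.fromLeftDerivedZero' G =
      P.fromLeftDerivedZero' F ≫ α.app X := by
    rw [← cancel_epi (HomologicalComplex.pOpcycles _ _),
      HomologicalComplex.p_opcyclesMap_assoc]
    simp only [ProjectiveResolution.pOpcycles_comp_fromLeftDerivedZero',
      ProjectiveResolution.pOpcycles_comp_fromLeftDerivedZero'_assoc]
    exact (α.naturality _).symm
  have e : Arrow.mk (HomologicalComplex.homologyMap φ 0) ≅ Arrow.mk (α.app X) :=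
    Arrow.isoMk (ChainComplex.isoHomologyι₀ _ ≪≫ asIso (P.fromLeftDerivedZero' F))
      (ChainComplex.isoHomologyι₀ _ ≪≫ asIso (P.fromLeftDerivedZero' G)) (by
        simp only [Arrow.mk_hom, Iso.trans_hom, asIso_hom, Category.assoc]
        rw [← h₂, reassoc_of% h₁])
  exact (P.isoLeftDerivedObj H 1).isZero_iff.trans
    (hδ.trans ((MorphismProperty.monomorphisms D).arrow_mk_iso_iff e))

end LeftDerived

section Tor

open MonoidalCategory

variable {A : Type u} [CommRing A]

instance (M : ModuleCat.{u} A) : PreservesFiniteColimits ((tensoringLeft (ModuleCat.{u} A)).obj M) :=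
  inferInstanceAs (PreservesFiniteColimits (tensorLeft M))

lemma isZero_Tor_succ_of_flat (F N : ModuleCat.{u} A) [Module.Flat A F] (n : ℕ) :
    IsZero (((Tor (ModuleCat.{u} A) (n + 1)).obj F).obj N) := by
  have : PreservesFiniteLimits ((tensoringLeft (ModuleCat.{u} A)).obj F) :=
    inferInstanceAs (PreservesFiniteLimits (tensorLeft F))
  exact isZero_leftDerived_succ_of_preservesHomology ((tensoringLeft (ModuleCat.{u} A)).obj F) N n

/-- A short exact sequence of modules stays short exact after tensoring with a projective. -/
lemma tensoringLeft_shortExact {S : ShortComplex (ModuleCat.{u} A)} (hS : S.ShortExact)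
    (w : (tensoringLeft (ModuleCat.{u} A)).map S.f ≫ (tensoringLeft _).map S.g = 0)
    (P : ModuleCat.{u} A) [Projective P] :
    (ShortComplex.mk (((tensoringLeft (ModuleCat.{u} A)).map S.f).app P)
      (((tensoringLeft (ModuleCat.{u} A)).map S.g).app P) (congr_app w P)).ShortExact := by
  have : Module.Projective A P := (IsProjective.iff_projective P).2 inferInstance
  exact hS.map_of_exact (tensorRight P)

lemma tensoringLeft_map_comp_eq_zero (S : ShortComplex (ModuleCat.{u} A)) :
    (tensoringLeft (ModuleCat.{u} A)).map S.f ≫ (tensoringLeft _).map S.g = 0 := by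
  rw [← Functor.map_comp, S.zero]
  ext1
  ext1 P
  exact MonoidalPreadditive.zero_whiskerRight

variable {S : ShortComplex (ModuleCat.{u} A)} (hS : S.ShortExact) [Module.Flat A S.X₂]
  (N : ModuleCat.{u} A)

include hS in
lemma isZero_Tor_add_two_iff (n : ℕ) :
    IsZero (((Tor (ModuleCat.{u} A) (n + 2)).obj S.X₃).obj N) ↔
      IsZero (((Tor (ModuleCat.{u} A) (n + 1)).obj S.X₁).obj N) :=
  isZero_leftDerived_add_two_iff _ _ (tensoringLeft_map_comp_eq_zero S)
    (fun P _ => tensoringLeft_shortExact hS (tensoringLeft_map_comp_eq_zero S) P) N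
    (isZero_Tor_succ_of_flat S.X₂ N) n

include hS in
lemma isZero_Tor_one_iff :
    IsZero (((Tor (ModuleCat.{u} A) 1).obj S.X₃).obj N) ↔ Mono (S.f ▷ N) :=
  isZero_leftDerived_one_iff _ _ (tensoringLeft_map_comp_eq_zero S)
    (fun P _ => tensoringLeft_shortExact hS (tensoringLeft_map_comp_eq_zero S) P) N
    (isZero_Tor_succ_of_flat S.X₂ N 0)

end Tor

section BaseChange

lemma lTensor_injective_iff_of_faithfullyFlat {A : Type*} [CommRing A] (R S : Type*) [CommRing R]
    [CommRing S] [Algebra A R] [Algebra A S] [Algebra R S] [IsScalarTower A R S]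
    [Module.FaithfullyFlat R S] {K F : Type*} [AddCommGroup K] [Module A K] [AddCommGroup F]
    [Module A F] (f : K →ₗ[A] F) :
    Function.Injective (f.lTensor S) ↔ Function.Injective (f.lTensor R) := by
  have h := congr_arg DFunLike.coe
    (AlgebraTensorModule.lTensor_comp_cancelBaseChange A R S (M := S) f)
  have h₁ : Function.Injective
      (f.lTensor S ∘ AlgebraTensorModule.cancelBaseChange A R S S K) ↔
      Function.Injective (AlgebraTensorModule.cancelBaseChange A R S S F ∘
        (AlgebraTensorModule.lTensor R R f).lTensor S) :=
    iff_of_eq (congr_arg Function.Injective h)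
  rw [EquivLike.injective_comp, EquivLike.comp_injective,
    Module.FaithfullyFlat.lTensor_injective_iff_injective R S] at h₁
  exact h₁

/-- Vanishing of Tor can be checked after a faithfully flat base change in the second argument. -/
lemma isZero_Tor_succ_iff_of_faithfullyFlat {A : Type u} [CommRing A] (R S : Type u) [CommRing R]
    [CommRing S] [Algebra A R] [Algebra A S] [Algebra R S] [IsScalarTower A R S]
    [Module.FaithfullyFlat R S] (n : ℕ) (M : ModuleCat.{u} A) :
    IsZero (((Tor (ModuleCat.{u} A) (n + 1)).obj M).obj (ModuleCat.of A R)) ↔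
      IsZero (((Tor (ModuleCat.{u} A) (n + 1)).obj M).obj (ModuleCat.of A S)) := by
  induction n generalizing M with
  | zero =>
    have hS := M.shortExact_projectiveShortComplex
    refine (isZero_Tor_one_iff hS _).trans (Iff.trans ?_ (isZero_Tor_one_iff hS _).symm)
    rw [ModuleCat.mono_iff_injective, ModuleCat.mono_iff_injective]
    have h := lTensor_injective_iff_of_faithfullyFlat R S M.projectiveShortComplex.f.hom
    rw [LinearMap.lTensor_inj_iff_rTensor_inj, LinearMap.lTensor_inj_iff_rTensor_inj] at h
    exact h.symm
  | succ n ih =>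
    have hS := M.shortExact_projectiveShortComplex
    exact (isZero_Tor_add_two_iff hS _ n).trans ((ih _).trans (isZero_Tor_add_two_iff hS _ n).symm)

end BaseChange

/-- Let `J ⊆ A` be a finitely generated ideal and `B` an `A`-algebra with
`Tor_i^A(B, A/J) = 0` for all `i ≥ 1` and `B/JB` faithfully flat over `A/J`
(here `B/JB` is realized as `(A/J) ⊗[A] B`). Then for any `A`-module `M`:
`M` is `J`-completely flat (`Tor_i^A(M, A/J) = 0` for `i ≥ 1` and `M/JM` flat over `A/J`)
iff `Tor_i^A(M, B/JB) = 0` for `i ≥ 1` and `M ⊗_A (B/JB)` is flat over `B/JB`. -/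
theorem completelyFlat_descends (A : Type u) [CommRing A] (J : Ideal A) (hJ : J.FG)
    (B : Type u) [CommRing B] [Algebra A B]
    (hTorB : TorVanish A B (A ⧸ J))
    (hff : Module.FaithfullyFlat (A ⧸ J) ((A ⧸ J) ⊗[A] B))
    (M : Type u) [AddCommGroup M] [Module A M] :
    (TorVanish A M (A ⧸ J) ∧ Module.Flat (A ⧸ J) ((A ⧸ J) ⊗[A] M)) ↔
    (TorVanish A M ((A ⧸ J) ⊗[A] B) ∧
      Module.Flat ((A ⧸ J) ⊗[A] B) (((A ⧸ J) ⊗[A] B) ⊗[A] M)) := by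
  have hTor (N : Type u) [AddCommGroup N] [Module A N] : TorVanish A M N ↔
      ∀ n : ℕ, IsZero (((Tor (ModuleCat.{u} A) (n + 1)).obj (ModuleCat.of A M)).obj
        (ModuleCat.of A N)) := by
    refine ⟨fun h n => ?_, fun h i hi => ?_⟩
    · have := h (n + 1) (by omega)
      exact ModuleCat.isZero_of_subsingleton _
    · obtain ⟨n, rfl⟩ := Nat.exists_eq_add_of_le' hi
      exact ModuleCat.subsingleton_of_isZero (h n)
  rw [hTor, hTor]
  refine and_congr (forall_congr' fun n =>
    isZero_Tor_succ_iff_of_faithfullyFlat (A ⧸ J) ((A ⧸ J) ⊗[A] B) n (ModuleCat.of A M)) ?_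
  rw [← Module.Flat.iff_flat_tensorProduct (A ⧸ J) ((A ⧸ J) ⊗[A] M) ((A ⧸ J) ⊗[A] B)]
  exact Module.Flat.equiv_iff (AlgebraTensorModule.cancelBaseChange A (A ⧸ J)
    ((A ⧸ J) ⊗[A] B) ((A ⧸ J) ⊗[A] B) M)
end

section
/- Let A be a commutative ring and f ∈ A such that A is derived f-complete and A has bounded f^∞-torsion (i.e. (A,(f)) is of reduced prismatic type). Then A is classically f-adically complete: the canonical ring homomorphism A → lim_n A/f^nA is an isomorphism. -/
open CategoryTheory

universe u

open Limits in
/-- If `Ext¹(Z, Y)` vanishes, then every `1`-cocycle of a projective resolution of `Z` with values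
in `Y` is a coboundary. -/
theorem CategoryTheory.ProjectiveResolution.exists_d_comp_eq_of_subsingleton_ext
    {R C : Type*} [Ring R] [Category* C] [Abelian C] [Linear R C] [EnoughProjectives C]
    {Z Y : C} (P : ProjectiveResolution Z)
    (hExt : Subsingleton (((Ext R C 1).obj (Opposite.op Z)).obj Y))
    (g : P.complex.X 1 ⟶ Y) (hg : P.complex.d 2 1 ≫ g = 0) :
    ∃ h : P.complex.X 0 ⟶ Y, P.complex.d 1 0 ≫ h = g := by
  have hzero : IsZero ((P.complex.linearYonedaObj R Y).homology 1) :=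
    (ModuleCat.isZero_of_subsingleton _).of_iso (P.isoExt 1 Y).symm
  rw [← HomologicalComplex.exactAt_iff_isZero_homology,
    HomologicalComplex.exactAt_iff' _ 0 1 2 (by simp) (by simp),
    ShortComplex.moduleCat_exact_iff] at hzero
  exact hzero g hg

/-- If `Ext¹` of the cokernel of a monomorphism between projectives vanishes, then
every morphism out of the source extends to the target. -/
theorem CategoryTheory.ShortComplex.ShortExact.exists_f_comp_eq_of_subsingleton_ext
    {R C : Type*} [Ring R] [Category* C] [Abelian C] [Linear R C] [EnoughProjectives C]
    {S : ShortComplex C} (hS : S.ShortExact) [Projective S.X₁] [Projective S.X₂] {Y : C}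
    (hExt : Subsingleton (((Ext R C 1).obj (Opposite.op S.X₃)).obj Y)) (φ : S.X₁ ⟶ Y) :
    ∃ ψ : S.X₂ ⟶ Y, S.f ≫ ψ = φ := by
  have := hS.mono_f
  have := hS.epi_g
  let P := projectiveResolution S.X₃
  let ε : P.complex.X 0 ⟶ S.X₃ := P.π.f 0
  have hε : P.complex.d 1 0 ≫ ε = 0 := P.complex_d_comp_π_f_zero
  have hεe : Epi ε := inferInstanceAs (Epi (P.π.f 0))
  have hεx : (ShortComplex.mk _ _ hε).Exact := P.exact₀
  let α₀ : P.complex.X 0 ⟶ S.X₂ := Projective.factorThru ε S.g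
  have hα₀ : α₀ ≫ S.g = ε := Projective.factorThru_comp _ _
  let α₁ := hS.exact.lift (P.complex.d 1 0 ≫ α₀) (by rw [Category.assoc, hα₀, hε])
  have hα₁ : α₁ ≫ S.f = P.complex.d 1 0 ≫ α₀ := hS.exact.lift_f _ _
  let β₀ : S.X₂ ⟶ P.complex.X 0 := Projective.factorThru S.g ε
  have hβ₀ : β₀ ≫ ε = S.g := Projective.factorThru_comp _ _
  let β₁ : S.X₁ ⟶ P.complex.X 1 := hεx.liftFromProjective (S.f ≫ β₀) (by
    simp [hβ₀])
  have hβ₁ : β₁ ≫ P.complex.d 1 0 = S.f ≫ β₀ := hεx.liftFromProjective_comp _ _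
  let s := hS.exact.lift (𝟙 _ - β₀ ≫ α₀) (by simp [hα₀, hβ₀])
  have hs : s ≫ S.f = 𝟙 _ - β₀ ≫ α₀ := hS.exact.lift_f _ _
  obtain ⟨h, hh⟩ := P.exists_d_comp_eq_of_subsingleton_ext hExt (α₁ ≫ φ) (by
    have : P.complex.d 2 1 ≫ α₁ = 0 := by
      rw [← cancel_mono S.f, Category.assoc, hα₁]
      simp
    rw [reassoc_of% this, Limits.zero_comp])
  have key : β₁ ≫ α₁ + S.f ≫ s = 𝟙 _ := by
    rw [← cancel_mono S.f, Preadditive.add_comp, Category.assoc, Category.assoc, hα₁, hs,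
      reassoc_of% hβ₁]
    simp
  refine ⟨β₀ ≫ h + s ≫ φ, ?_⟩
  rw [Preadditive.comp_add, ← reassoc_of% hβ₁, hh, ← Category.assoc, ← Category.assoc,
    ← Preadditive.add_comp, key, Category.id_comp]

open Polynomial

section Telescope

variable {A : Type u} [CommRing A] (f : A)

/-- The presentation `A[X] → A_f`, `X ↦ 1 / f`. -/
noncomputable def polynomialToAway : A[X] →ₗ[A] Localization.Away f :=
  (Localization.awayEquivAdjoin f).symm.toLinearMap ∘ₗ (AdjoinRoot.mkₐ (C f * X - 1)).toLinearMap

theorem polynomialToAway_surjective : Function.Surjective (polynomialToAway f) :=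
  (Localization.awayEquivAdjoin f).symm.surjective.comp AdjoinRoot.mk_surjective

theorem polynomialToAway_eq_zero_iff (p : A[X]) :
    polynomialToAway f p = 0 ↔ (C f * X - 1) ∣ p := by
  rw [← AdjoinRoot.mk_eq_zero]
  exact (Localization.awayEquivAdjoin f).symm.map_eq_zero_iff

theorem C_mul_X_sub_one_mul_injective :
    Function.Injective fun p : A[X] ↦ (C f * X - 1) * p := by
  have hunit : IsUnit ((C f * X - 1 : A[X]) : PowerSeries A) := by
    rw [PowerSeries.isUnit_iff_constantCoeff]
    simp
  intro p q hpq
  apply Polynomial.coe_injective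
  apply hunit.mul_left_cancel
  simpa only [← Polynomial.coe_mul] using congrArg _ hpq

/-- `A_f` as the cokernel of multiplication by `f X - 1` on `A[X]`. -/
noncomputable def awayShortComplex : ShortComplex (ModuleCat.{u} A) :=
  .mk (ModuleCat.ofHom (LinearMap.mulLeft A (C f * X - 1 : A[X])))
    (ModuleCat.ofHom (polynomialToAway f)) (by
      ext1
      refine LinearMap.ext fun p ↦ ?_
      exact (polynomialToAway_eq_zero_iff f _).2 (dvd_mul_right _ _))

theorem awayShortComplex_shortExact : (awayShortComplex f).ShortExact where
  exact := by
    rw [ShortComplex.moduleCat_exact_iff]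
    intro p hp
    obtain ⟨q, rfl⟩ := (polynomialToAway_eq_zero_iff f p).1 hp
    exact ⟨q, rfl⟩
  mono_f := (ModuleCat.mono_iff_injective _).2 (C_mul_X_sub_one_mul_injective f)
  epi_g := (ModuleCat.epi_iff_surjective _).2 (polynomialToAway_surjective f)

variable {f} {M : Type u} [AddCommGroup M] [Module A M]

/-- The linear map `A[X] → M` with `X ^ n ↦ z n`. -/
noncomputable def polynomialLift (z : ℕ → M) : A[X] →ₗ[A] M :=
  (Polynomial.basisMonomials A).constr A z

theorem polynomialLift_X_pow (z : ℕ → M) (n : ℕ) :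
    polynomialLift z (X ^ n : A[X]) = z n := by
  simpa [polynomialLift, X_pow_eq_monomial] using
    (Polynomial.basisMonomials A).constr_basis A z n

theorem DerivedComplete.eq_zero_of_eq_smul_succ (h : DerivedComplete A f M) {z : ℕ → M}
    (hz : ∀ n, z n = f • z (n + 1)) : z = 0 := by
  have hker : (polynomialToAway f).ker ≤ (polynomialLift z).ker := by
    intro p hp
    obtain ⟨q, rfl⟩ := (polynomialToAway_eq_zero_iff f p).1 hp
    have : polynomialLift z ∘ₗ LinearMap.mulLeft A (C f * X - 1 : A[X]) = 0 := by
      refine (Polynomial.basisMonomials A).ext fun n ↦ ?_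
      have : (C f * X - 1) * X ^ n = f • X ^ (n + 1) - X ^ n := by
        rw [smul_eq_C_mul]; ring
      simp [← X_pow_eq_monomial, this, polynomialLift_X_pow, ← hz]
    exact LinearMap.congr_fun this q
  let g : Localization.Away f →ₗ[A] M :=
    (polynomialToAway f).ker.liftQ (polynomialLift z) hker ∘ₗ
      ((polynomialToAway f).quotKerEquivOfSurjective (polynomialToAway_surjective f)).symm
  have hg (p : A[X]) : g (polynomialToAway f p) = polynomialLift z p := by
    simp [g]
  funext n
  rw [← polynomialLift_X_pow (A := A) z n, ← hg, h.1 g]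
  rfl

theorem DerivedComplete.exists_sub_smul_succ_eq (h : DerivedComplete A f M) (a : ℕ → M) :
    ∃ x : ℕ → M, ∀ n, x n - f • x (n + 1) = a n := by
  have : Projective (awayShortComplex f).X₁ :=
    inferInstanceAs (Projective (ModuleCat.of A A[X]))
  have : Projective (awayShortComplex f).X₂ :=
    inferInstanceAs (Projective (ModuleCat.of A A[X]))
  obtain ⟨ψ, hψ⟩ := (awayShortComplex_shortExact f).exists_f_comp_eq_of_subsingleton_ext h.2
    (ModuleCat.ofHom (polynomialLift a))
  let ψ' : A[X] →ₗ[A] M := ψ.hom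
  refine ⟨fun n ↦ -ψ' (X ^ n), fun n ↦ ?_⟩
  have hn : ψ' ((C f * X - 1) * X ^ n) = polynomialLift a (X ^ n : A[X]) :=
    LinearMap.congr_fun (congrArg ModuleCat.Hom.hom hψ) (X ^ n : A[X])
  have hX : (C f * X - 1) * X ^ n = f • X ^ (n + 1) - X ^ n := by
    rw [smul_eq_C_mul]; ring
  rw [hX, polynomialLift_X_pow, map_sub, map_smul] at hn
  rw [← hn, smul_neg, neg_sub_neg]

end Telescope

theorem DerivedComplete.isPrecomplete {A : Type u} [CommRing A] {f : A}
    (h : DerivedComplete A f A) : IsPrecomplete (Ideal.span {f}) A where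
  prec' u hu := by
    simp only [Ideal.span_singleton_pow, smul_eq_mul, Ideal.mul_top, SModEq.sub_mem,
      Ideal.mem_span_singleton] at hu ⊢
    choose a ha using fun n ↦ hu (Nat.le_succ n)
    obtain ⟨x, hx⟩ := h.exists_sub_smul_succ_eq fun n ↦ -a n
    have hsum (n : ℕ) : u n = u 0 + x 0 - f ^ n * x n := by
      induction n with
      | zero => simp
      | succ n ih =>
        have := hx n
        rw [smul_eq_mul] at this
        linear_combination ih - ha n - f ^ n * this
    exact ⟨u 0 + x 0, fun n ↦ ⟨-x n, by rw [hsum n]; ring⟩⟩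

theorem DerivedComplete.isHausdorff {A : Type u} [CommRing A] {f : A}
    (h : DerivedComplete A f A)
    (hbdd : ∃ c : ℕ, ∀ x : A, (∃ n : ℕ, f ^ n * x = 0) → f ^ c * x = 0) :
    IsHausdorff (Ideal.span {f}) A where
  haus' x hx := by
    simp only [Ideal.span_singleton_pow, smul_eq_mul, Ideal.mul_top, SModEq.zero,
      Ideal.mem_span_singleton] at hx
    obtain ⟨c, hc⟩ := hbdd
    choose y hy using hx
    have hz := h.eq_zero_of_eq_smul_succ (z := fun n ↦ f ^ c * y (n + c)) fun n ↦ by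
      have := hc (y (n + c) - f * y (n + 1 + c)) ⟨n + c, by
        linear_combination hy (n + 1 + c) - hy (n + c)⟩
      rw [smul_eq_mul]
      linear_combination this
    simpa [hy c] using congrFun hz 0

/-- If `A` is derived `f`-complete and has bounded `f^∞`-torsion
(i.e. `(A,(f))` is of reduced prismatic type), then `A` is classically `f`-adically
complete. -/
theorem isAdicComplete_of_reducedPrismaticType (A : Type u) [CommRing A] (f : A)
    (hder : DerivedComplete A f A)
    (hbdd : ∃ c : ℕ, ∀ x : A, (∃ n : ℕ, f ^ n * x = 0) → f ^ c * x = 0) :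
    IsAdicComplete (Ideal.span {f}) A := by
  have := hder.isHausdorff hbdd
  have := hder.isPrecomplete
  exact {}
end

section
/- Let (A,(f)) be of reduced prismatic type. Let M be an A-module which is (f)-completely flat, i.e. Tor_i^A(M, A/fA) = 0 for all i ≥ 1 and M/fM is flat over A/fA. Then for every n ≥ 1 the A/f^nA-module M/f^nM is flat; moreover the f-adic completion M^∧ = lim_n M/f^nM is f-adically complete and the canonical map M^∧/f^nM^∧ → M/f^nM is an isomorphism for every n ≥ 1. If in addition M/fM is faithfully flat over A/fA, then each M/f^nM is faithfully flat over A/f^nA. -/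
set_option synthInstance.maxHeartbeats 400000

open TensorProduct CategoryTheory

universe u

section TensorDiagram

variable {R : Type*} [CommRing R] {L F M K P N : Type*}
  [AddCommGroup L] [Module R L] [AddCommGroup F] [Module R F] [AddCommGroup M] [Module R M]
  [AddCommGroup K] [Module R K] [AddCommGroup P] [Module R P] [AddCommGroup N] [Module R N]

/-- Symmetry of `Tor₁`, as a chase in the tensor product of two presentations. -/
theorem lTensor_injective_of_rTensor_injective {i : L →ₗ[R] F} {p : F →ₗ[R] M}
    (hip : Function.Exact i p) (hp : Function.Surjective p)
    {j : K →ₗ[R] P} {q : P →ₗ[R] N} (hjq : Function.Exact j q) (hq : Function.Surjective q)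
    (hF : Function.Injective (j.lTensor F)) (h : Function.Injective (i.rTensor N)) :
    Function.Injective (j.lTensor M) := by
  rw [injective_iff_map_eq_zero]
  intro x hx
  obtain ⟨y, rfl⟩ := LinearMap.rTensor_surjective K hp x
  have h1 : p.rTensor P (j.lTensor F y) = 0 := by
    rw [← hx, ← LinearMap.comp_apply, ← LinearMap.comp_apply, LinearMap.rTensor_comp_lTensor,
      LinearMap.lTensor_comp_rTensor]
  obtain ⟨z, hz⟩ := (rTensor_exact P hip hp _).1 h1
  have h2 : i.rTensor N (q.lTensor L z) = 0 := by
    rw [← LinearMap.comp_apply, LinearMap.rTensor_comp_lTensor, ← LinearMap.lTensor_comp_rTensor,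
      LinearMap.comp_apply, hz]
    exact (lTensor_exact F hjq hq).apply_apply_eq_zero y
  obtain ⟨w, hw⟩ := (lTensor_exact L hjq hq _).1 ((map_eq_zero_iff _ h).1 h2)
  have h3 : i.rTensor K w = y := by
    apply hF
    rw [← hz, ← hw, ← LinearMap.comp_apply, ← LinearMap.comp_apply,
      LinearMap.rTensor_comp_lTensor, LinearMap.lTensor_comp_rTensor]
  rw [← h3]
  exact (rTensor_exact K hip hp).apply_apply_eq_zero w

theorem rTensor_injective_of_lTensor_injective {i : L →ₗ[R] F} {p : F →ₗ[R] M}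
    (hip : Function.Exact i p) (hp : Function.Surjective p)
    {j : K →ₗ[R] P} {q : P →ₗ[R] N} (hjq : Function.Exact j q) (hq : Function.Surjective q)
    (hP : Function.Injective (i.rTensor P)) (h : Function.Injective (j.lTensor M)) :
    Function.Injective (i.rTensor N) := by
  rw [← LinearMap.lTensor_inj_iff_rTensor_inj] at hP ⊢
  rw [LinearMap.lTensor_inj_iff_rTensor_inj] at h
  exact lTensor_injective_of_rTensor_injective hjq hq hip hp hP h

/-- If the cokernel of an injection is flat, the injection is universally injective. -/
theorem rTensor_injective_of_flat_cokernel {i : L →ₗ[R] F} {p : F →ₗ[R] M}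
    (hi : Function.Injective i) (hip : Function.Exact i p) (hp : Function.Surjective p)
    [Module.Flat R M] (N : Type*) [AddCommGroup N] [Module R N] :
    Function.Injective (i.rTensor N) := by
  let q : (N →₀ R) →ₗ[R] N := Finsupp.linearCombination R id
  have hq : Function.Surjective q := Finsupp.linearCombination_id_surjective R N
  exact rTensor_injective_of_lTensor_injective hip hp q.exact_subtype_ker_map hq
    (Module.Flat.rTensor_preserves_injective_linearMap i hi)
    (Module.Flat.lTensor_preserves_injective_linearMap _ (Submodule.injective_subtype _))

/-- `Tor₁`-vanishing is stable under extensions. -/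
theorem rTensor_injective_of_exact {i : L →ₗ[R] F}
    {j : K →ₗ[R] P} {q : P →ₗ[R] N} (hjq : Function.Exact j q) (hq : Function.Surjective q)
    (hF : Function.Injective (j.lTensor F))
    (hK : Function.Injective (i.rTensor K)) (hN : Function.Injective (i.rTensor N)) :
    Function.Injective (i.rTensor P) := by
  rw [injective_iff_map_eq_zero]
  intro x hx
  have h1 : i.rTensor N (q.lTensor L x) = 0 := by
    rw [← LinearMap.comp_apply, LinearMap.rTensor_comp_lTensor, ← LinearMap.lTensor_comp_rTensor,
      LinearMap.comp_apply, hx, map_zero]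
  obtain ⟨w, rfl⟩ := (lTensor_exact L hjq hq _).1 ((map_eq_zero_iff _ hN).1 h1)
  have h2 : j.lTensor F (i.rTensor K w) = 0 := by
    rw [← hx, ← LinearMap.comp_apply, ← LinearMap.comp_apply,
      LinearMap.rTensor_comp_lTensor, LinearMap.lTensor_comp_rTensor]
  rw [(map_eq_zero_iff _ hK).1 ((map_eq_zero_iff _ hF).1 h2), map_zero]

end TensorDiagram

section LocalCriterion

variable {A : Type*} [CommRing A] {L F M : Type*}
  [AddCommGroup L] [Module A L] [AddCommGroup F] [Module A F] [AddCommGroup M] [Module A M]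

theorem lTensor_baseChange_injective_iff {B : Type*} [CommRing B] [Algebra A B]
    (i : L →ₗ[A] F) (N : Type*) [AddCommGroup N] [Module A N] [Module B N] [IsScalarTower A B N] :
    Function.Injective ((i.baseChange B).lTensor N) ↔ Function.Injective (i.lTensor N) := by
  let eL := AlgebraTensorModule.cancelBaseChange A B B N L
  let eF := AlgebraTensorModule.cancelBaseChange A B B N F
  have h : AlgebraTensorModule.lTensor B N i ∘ₗ eL.toLinearMap =
      eF.toLinearMap ∘ₗ (i.baseChange B).lTensor N := by
    ext; simp [eL, eF]
  have h' : ⇑(i.lTensor N) ∘ eL = eF ∘ ((i.baseChange B).lTensor N) :=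
    funext (LinearMap.congr_fun h)
  rw [← eF.injective.of_comp_iff, ← h', ← EquivLike.injective_comp eL]

theorem lTensor_injective_iff_baseChange_lTensor {B : Type*} [CommRing B] [Algebra A B]
    {N N' : Type*} [AddCommGroup N] [Module A N] [Module B N] [IsScalarTower A B N]
    [AddCommGroup N'] [Module A N'] [Module B N'] [IsScalarTower A B N'] (g : N →ₗ[B] N') :
    Function.Injective (g.lTensor (B ⊗[A] M)) ↔
      Function.Injective ((g.restrictScalars A).lTensor M) := by
  let e := AlgebraTensorModule.cancelBaseChange A B B N M
  let e' := AlgebraTensorModule.cancelBaseChange A B B N' M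
  have h : AlgebraTensorModule.rTensor A M g ∘ₗ e.toLinearMap =
      e'.toLinearMap ∘ₗ g.rTensor (B ⊗[A] M) := by
    ext; simp [e, e']
  have h' : ⇑((g.restrictScalars A).rTensor M) ∘ e = e' ∘ (g.rTensor (B ⊗[A] M)) :=
    funext (LinearMap.congr_fun h)
  rw [LinearMap.lTensor_inj_iff_rTensor_inj, LinearMap.lTensor_inj_iff_rTensor_inj,
    ← e'.injective.of_comp_iff, ← h', ← EquivLike.injective_comp e]

variable {I : Ideal A} {i : L →ₗ[A] F} {p : F →ₗ[A] M}

theorem rTensor_injective_of_isTorsionBySet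
    (hip : Function.Exact i p) (hp : Function.Surjective p)
    (hI : Function.Injective (i.rTensor (A ⧸ I))) [Module.Flat (A ⧸ I) ((A ⧸ I) ⊗[A] M)]
    (N : Type*) [AddCommGroup N] [Module A N] (hN : Module.IsTorsionBySet A N (I : Set A)) :
    Function.Injective (i.rTensor N) := by
  let _ : Module (A ⧸ I) N := hN.module
  have : IsScalarTower A (A ⧸ I) N := hN.isScalarTower
  rw [← LinearMap.lTensor_inj_iff_rTensor_inj] at hI ⊢
  rw [← lTensor_baseChange_injective_iff (B := A ⧸ I), LinearMap.lTensor_inj_iff_rTensor_inj]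
  exact rTensor_injective_of_flat_cokernel (i := i.baseChange (A ⧸ I))
    (p := p.baseChange (A ⧸ I)) hI (lTensor_exact (A ⧸ I) hip hp)
    (LinearMap.lTensor_surjective (A ⧸ I) hp) N

theorem rTensor_injective_of_isTorsionBySet_pow [Module.Flat A F]
    (hip : Function.Exact i p) (hp : Function.Surjective p)
    (hI : Function.Injective (i.rTensor (A ⧸ I))) [Module.Flat (A ⧸ I) ((A ⧸ I) ⊗[A] M)]
    (n : ℕ) (N : Type*) [AddCommGroup N] [Module A N]
    (hN : Module.IsTorsionBySet A N ((I ^ n : Ideal A) : Set A)) :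
    Function.Injective (i.rTensor N) := by
  induction n generalizing N with
  | zero =>
    have : Subsingleton N := subsingleton_of_forall_eq 0 fun x ↦ by
      simpa using @hN x ⟨1, by simp⟩
    exact Function.injective_of_subsingleton _
  | succ n ih =>
    refine rTensor_injective_of_exact (j := (I • (⊤ : Submodule A N)).subtype)
      (q := (I • (⊤ : Submodule A N)).mkQ) (LinearMap.exact_subtype_mkQ _)
      (Submodule.mkQ_surjective _)
      (Module.Flat.lTensor_preserves_injective_linearMap _ (Submodule.injective_subtype _))
      (ih _ ?_) (rTensor_injective_of_isTorsionBySet hip hp hI _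
        (Module.isTorsionBySet_quotient_ideal_smul N I))
    rintro ⟨x, hx⟩ ⟨a, ha⟩
    ext
    change a • x = 0
    induction hx using Submodule.smul_induction_on' with
    | smul r hr y _ =>
      rw [smul_smul]
      exact @hN y ⟨a * r, pow_succ I n ▸ Ideal.mul_mem_mul ha hr⟩
    | add x _ y _ hx hy => rw [smul_add, hx, hy, add_zero]

/-- The local criterion of flatness: if `M / I M` is flat over `A / I` and `Tor₁ᴬ(M, A / I) = 0`
(as witnessed by a flat presentation of `M`), then `M / Iⁿ M` is flat over `A / Iⁿ`. -/
theorem flat_quotient_pow [Module.Flat A F]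
    (hip : Function.Exact i p) (hp : Function.Surjective p)
    (hI : Function.Injective (i.rTensor (A ⧸ I))) [Module.Flat (A ⧸ I) ((A ⧸ I) ⊗[A] M)]
    (n : ℕ) : Module.Flat (A ⧸ I ^ n) ((A ⧸ I ^ n) ⊗[A] M) := by
  rw [Module.Flat.iff_lTensor_preserves_injective_linearMap]
  intro N N' _ _ _ _ g hg
  let _ : Module A N := Module.compHom N (algebraMap A (A ⧸ I ^ n))
  let _ : Module A N' := Module.compHom N' (algebraMap A (A ⧸ I ^ n))
  have : IsScalarTower A (A ⧸ I ^ n) N := .of_compHom ..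
  have : IsScalarTower A (A ⧸ I ^ n) N' := .of_compHom ..
  rw [lTensor_injective_iff_baseChange_lTensor]
  let g' := g.restrictScalars A
  refine lTensor_injective_of_rTensor_injective hip hp (j := g') (q := (LinearMap.range g').mkQ)
    (LinearMap.exact_map_mkQ_range g') (Submodule.mkQ_surjective _)
    (Module.Flat.lTensor_preserves_injective_linearMap _ hg)
    (rTensor_injective_of_isTorsionBySet_pow hip hp hI n _ ?_)
  rintro x ⟨a, ha⟩
  obtain ⟨x, rfl⟩ := Submodule.mkQ_surjective _ x
  rw [← map_smul]
  change Submodule.mkQ _ (a • x) = 0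
  rw [← algebraMap_smul (A ⧸ I ^ n) a x, Ideal.Quotient.algebraMap_eq,
    Ideal.Quotient.eq_zero_iff_mem.2 ha, zero_smul, map_zero]

theorem faithfullyFlat_quotient_pow [Module.FaithfullyFlat (A ⧸ I) ((A ⧸ I) ⊗[A] M)]
    (n : ℕ) [Module.Flat (A ⧸ I ^ n) ((A ⧸ I ^ n) ⊗[A] M)] :
    Module.FaithfullyFlat (A ⧸ I ^ n) ((A ⧸ I ^ n) ⊗[A] M) := by
  rw [Module.FaithfullyFlat.iff_flat_and_rTensor_reflects_triviality]
  refine ⟨inferInstance, fun N _ _ h ↦ ?_⟩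
  let _ : Module A N := Module.compHom N (algebraMap A (A ⧸ I ^ n))
  have : IsScalarTower A (A ⧸ I ^ n) N := .of_compHom ..
  have h1 : Subsingleton (N ⊗[A] M) :=
    (AlgebraTensorModule.cancelBaseChange A (A ⧸ I ^ n) (A ⧸ I ^ n) N M).symm.subsingleton
  let Q := N ⧸ I • (⊤ : Submodule A N)
  have h2 : Subsingleton (Q ⊗[A] M) :=
    (LinearMap.rTensor_surjective M (Submodule.mkQ_surjective (I • (⊤ : Submodule A N)))).subsingleton
  have hQ := Module.isTorsionBySet_quotient_ideal_smul N I
  let _ : Module (A ⧸ I) Q := hQ.module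
  have : IsScalarTower A (A ⧸ I) Q := hQ.isScalarTower
  have h3 : Subsingleton (Q ⊗[A ⧸ I] ((A ⧸ I) ⊗[A] M)) :=
    (AlgebraTensorModule.cancelBaseChange A (A ⧸ I) (A ⧸ I) Q M).subsingleton
  have h4 : Subsingleton Q :=
    (Module.FaithfullyFlat.subsingleton_tensorProduct_iff_left (A ⧸ I) _).1 h3
  have h5 : I • (⊤ : Submodule A N) = ⊤ := Submodule.Quotient.subsingleton_iff.1 h4
  have h6 : ∀ k, I ^ k • (⊤ : Submodule A N) = ⊤ := fun k ↦ by
    induction k with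
    | zero => simp
    | succ k ih => rw [pow_succ, Submodule.mul_smul, h5, ih]
  refine subsingleton_of_forall_eq 0 fun x ↦ ?_
  have hx : x ∈ I ^ n • (⊤ : Submodule A N) := by rw [h6 n]; exact Submodule.mem_top
  induction hx using Submodule.smul_induction_on' with
  | smul r hr y _ =>
    rw [← algebraMap_smul (A ⧸ I ^ n) r y, Ideal.Quotient.algebraMap_eq,
      Ideal.Quotient.eq_zero_iff_mem.2 hr, zero_smul]
  | add x _ y _ hx hy => rw [hx, hy, add_zero]

end LocalCriterion

theorem lTensor_ker_subtype_injective {A : Type*} [CommRing A] {M N P₀ P₁ P₂ : Type*}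
    [AddCommGroup M] [Module A M] [AddCommGroup N] [Module A N] [AddCommGroup P₀] [Module A P₀]
    [AddCommGroup P₁] [Module A P₁] [AddCommGroup P₂] [Module A P₂]
    {d₂ : P₂ →ₗ[A] P₁} {d₁ : P₁ →ₗ[A] P₀} {q : P₀ →ₗ[A] N}
    (h₀ : Function.Exact d₁ q) (h₁ : Function.Exact d₂ d₁)
    (h : Function.Exact (d₂.lTensor M) (d₁.lTensor M)) :
    Function.Injective ((LinearMap.ker q).subtype.lTensor M) := by
  let e : P₁ →ₗ[A] LinearMap.ker q := d₁.codRestrict _ h₀.apply_apply_eq_zero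
  have he : Function.Surjective e := fun ⟨x, hx⟩ ↦ by
    obtain ⟨y, rfl⟩ := (h₀ x).1 hx
    exact ⟨y, rfl⟩
  rw [injective_iff_map_eq_zero]
  intro x hx
  obtain ⟨y, rfl⟩ := LinearMap.lTensor_surjective M he x
  rw [← LinearMap.comp_apply, ← LinearMap.lTensor_comp] at hx
  obtain ⟨z, rfl⟩ := (h y).1 hx
  rw [← LinearMap.comp_apply, ← LinearMap.lTensor_comp]
  have : e ∘ₗ d₂ = 0 := LinearMap.ext fun w ↦ Subtype.ext (h₁.apply_apply_eq_zero w)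
  rw [this, LinearMap.lTensor_zero, LinearMap.zero_apply]

/-- Vanishing of `Tor₁(M, N)` in terms of a projective presentation of `N`. -/
theorem exists_projective_lTensor_injective_of_subsingleton_Tor (A : Type u) [CommRing A]
    (M N : Type u) [AddCommGroup M] [Module A M] [AddCommGroup N] [Module A N]
    (h : Subsingleton
      (((Tor (ModuleCat.{u} A) 1).obj (ModuleCat.of A M)).obj (ModuleCat.of A N))) :
    ∃ (P : Type u) (_ : AddCommGroup P) (_ : Module A P) (q : P →ₗ[A] N),
      Module.Projective A P ∧ Function.Surjective q ∧
        Function.Injective ((LinearMap.ker q).subtype.lTensor M) := by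
  let P := projectiveResolution (ModuleCat.of A N)
  let G := (MonoidalCategory.tensoringLeft (ModuleCat.{u} A)).obj (ModuleCat.of A M)
  have h0 : Limits.IsZero ((G.leftDerived 1).obj (ModuleCat.of A N)) :=
    @ModuleCat.isZero_of_subsingleton _ _ _ h
  have h1 : ((G.mapHomologicalComplex (ComplexShape.down ℕ)).obj P.complex).ExactAt 1 := by
    rw [HomologicalComplex.exactAt_iff_isZero_homology]
    exact h0.of_iso (P.isoLeftDerivedObj G 1).symm
  rw [HomologicalComplex.exactAt_iff' _ 2 1 0 (by simp) (by simp),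
    ShortComplex.ShortExact.moduleCat_exact_iff_function_exact] at h1
  have h2 := P.exact₀
  have h3 := P.exact_succ 0
  rw [ShortComplex.ShortExact.moduleCat_exact_iff_function_exact] at h2 h3
  let d₁ := (P.complex.d 1 0).hom
  let d₂ := (P.complex.d 2 1).hom
  let q : P.complex.X 0 →ₗ[A] N := (P.π.f 0).hom
  replace h1 : Function.Exact (d₂.lTensor M) (d₁.lTensor M) := h1
  replace h2 : Function.Exact d₁ q := h2
  replace h3 : Function.Exact d₂ d₁ := h3
  refine ⟨P.complex.X 0, inferInstance, inferInstance, q,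
    (IsProjective.iff_projective _).2 (P.projective 0),
    (ModuleCat.epi_iff_surjective _).1 inferInstance, ?_⟩
  exact lTensor_ker_subtype_injective h2 h3 h1

/-- Let `(A,(f))` be of reduced prismatic type and `M` an `(f)`-completely
flat `A`-module (`Tor_i^A(M, A/fA) = 0` for `i ≥ 1` and `M/fM` flat over `A/fA`). Then each
`M/f^nM` is flat over `A/f^nA`; the `f`-adic completion `M^∧` is `f`-adically complete and the
canonical map `M^∧/f^nM^∧ → M/f^nM` is an isomorphism for every `n ≥ 1` (i.e. the evaluation
`M^∧ → M/f^nM` is surjective with kernel `f^nM^∧`); and if `M/fM` is faithfully flat over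
`A/fA` then each `M/f^nM` is faithfully flat over `A/f^nA`. -/
theorem completion_of_completelyFlat (A : Type u) [CommRing A] (f : A)
    (hder : DerivedComplete A f A)
    (hbdd : ∃ c : ℕ, ∀ x : A, (∃ n : ℕ, f ^ n * x = 0) → f ^ c * x = 0)
    (M : Type u) [AddCommGroup M] [Module A M]
    (hTor : TorVanish A M (A ⧸ Ideal.span {f}))
    (hflat : Module.Flat (A ⧸ Ideal.span {f}) ((A ⧸ Ideal.span {f}) ⊗[A] M)) :
    (∀ n : ℕ, 1 ≤ n →
      Module.Flat (A ⧸ (Ideal.span {f} ^ n)) ((A ⧸ (Ideal.span {f} ^ n)) ⊗[A] M)) ∧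
    IsAdicComplete (Ideal.span {f}) (AdicCompletion (Ideal.span {f}) M) ∧
    (∀ n : ℕ, 1 ≤ n →
      Function.Surjective (AdicCompletion.eval (Ideal.span {f}) M n) ∧
      LinearMap.ker (AdicCompletion.eval (Ideal.span {f}) M n) =
        (Ideal.span {f} ^ n • (⊤ : Submodule A (AdicCompletion (Ideal.span {f}) M)))) ∧
    (Module.FaithfullyFlat (A ⧸ Ideal.span {f}) ((A ⧸ Ideal.span {f}) ⊗[A] M) →
      ∀ n : ℕ, 1 ≤ n →
        Module.FaithfullyFlat (A ⧸ (Ideal.span {f} ^ n)) ((A ⧸ (Ideal.span {f} ^ n)) ⊗[A] M)) := by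
  let p : (M →₀ A) →ₗ[A] M := Finsupp.linearCombination A id
  have hp : Function.Surjective p := Finsupp.linearCombination_id_surjective A M
  have hip := p.exact_subtype_ker_map
  obtain ⟨P, _, _, q, _, hq, hinj⟩ :=
    exists_projective_lTensor_injective_of_subsingleton_Tor A M _ (hTor 1 le_rfl)
  have hI : Function.Injective ((LinearMap.ker p).subtype.rTensor (A ⧸ Ideal.span {f})) :=
    rTensor_injective_of_lTensor_injective hip hp q.exact_subtype_ker_map hq
      (Module.Flat.rTensor_preserves_injective_linearMap _ (Submodule.injective_subtype _)) hinj
  have hfg : (Ideal.span {f}).FG := ⟨{f}, by simp⟩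
  have hflat' := flat_quotient_pow (L := LinearMap.ker p) hip hp hI
  refine ⟨fun n _ ↦ hflat' n, AdicCompletion.isAdicComplete hfg, fun n _ ↦
    ⟨AdicCompletion.eval_surjective _ M n, (AdicCompletion.pow_smul_top_eq_ker_eval hfg).symm⟩,
    fun _ n _ ↦ ?_⟩
  have := hflat' n
  exact faithfullyFlat_quotient_pow n
end

section
/- Let A be a commutative ring and ξ, f ∈ A nonzerodivisors such that A is derived ξ-complete and derived f-complete and A/ξA has bounded f^∞-torsion. Then A is classically (ξ,f)-adically complete: the canonical ring homomorphism A → lim_n A/(ξ,f)^n is an isomorphism. -/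
open CategoryTheory

universe u

open Polynomial

theorem CategoryTheory.ProjectiveResolution.exists_d_comp_eq_of_subsingleton_ext_one
    (R : Type*) [CommRing R] {C : Type*} [Category C] [Abelian C] [Linear R C]
    [EnoughProjectives C] {X : C} (P : ProjectiveResolution X) {Y : C}
    (h : Subsingleton (((Ext R C 1).obj (Opposite.op X)).obj Y))
    (φ : P.complex.X 1 ⟶ Y) (hφ : P.complex.d 2 1 ≫ φ = 0) :
    ∃ χ : P.complex.X 0 ⟶ Y, P.complex.d 1 0 ≫ χ = φ := by
  have h0 := (ModuleCat.isZero_of_subsingleton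
    (((Ext R C 1).obj (Opposite.op X)).obj Y)).of_iso (P.isoExt 1 Y).symm
  rw [← HomologicalComplex.exactAt_iff_isZero_homology,
    HomologicalComplex.exactAt_iff' _ 0 1 2 (by simp) (by simp),
    ShortComplex.moduleCat_exact_iff] at h0
  exact h0 φ hφ

/-- If `Ext¹(X₃, Y)` vanishes, every morphism to `Y` from the first term of a two-term projective
resolution of `X₃` extends to the second term. -/
theorem CategoryTheory.ShortComplex.ShortExact.exists_comp_eq_of_subsingleton_ext_one
    (R : Type*) [CommRing R] {C : Type*} [Category C] [Abelian C] [Linear R C]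
    [EnoughProjectives C] {S : ShortComplex C} (hS : S.ShortExact) [Projective S.X₁]
    [Projective S.X₂] {Y : C} (h : Subsingleton (((Ext R C 1).obj (Opposite.op S.X₃)).obj Y))
    (φ : S.X₁ ⟶ Y) : ∃ ψ : S.X₂ ⟶ Y, S.f ≫ ψ = φ := by
  have := hS.mono_f
  have := hS.epi_g
  let P := projectiveResolution S.X₃
  let π : P.complex.X 0 ⟶ S.X₃ := P.π.f 0
  have hπ : Epi π := inferInstanceAs (Epi (P.π.f 0))
  have hdπ : P.complex.d 1 0 ≫ π = 0 := P.complex_d_comp_π_f_zero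
  have hP : (ShortComplex.mk _ _ hdπ).Exact := P.exact₀
  let h₀ : P.complex.X 0 ⟶ S.X₂ := Projective.factorThru π S.g
  have hh₀ : h₀ ≫ S.g = π := Projective.factorThru_comp _ _
  obtain ⟨h₁, hh₁⟩ : ∃ h₁ : P.complex.X 1 ⟶ S.X₁, h₁ ≫ S.f = P.complex.d 1 0 ≫ h₀ :=
    ⟨hS.exact.liftFromProjective (P.complex.d 1 0 ≫ h₀) (by rw [Category.assoc, hh₀, hdπ]),
      hS.exact.liftFromProjective_comp _ _⟩
  let s₀ : S.X₂ ⟶ P.complex.X 0 := Projective.factorThru S.g π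
  have hs₀ : s₀ ≫ π = S.g := Projective.factorThru_comp _ _
  obtain ⟨s₁, hs₁⟩ : ∃ s₁ : S.X₁ ⟶ P.complex.X 1, s₁ ≫ P.complex.d 1 0 = S.f ≫ s₀ :=
    ⟨hP.liftFromProjective (S.f ≫ s₀) (by simp [hs₀]), hP.liftFromProjective_comp _ _⟩
  obtain ⟨k, hk⟩ : ∃ k : S.X₂ ⟶ S.X₁, k ≫ S.f = s₀ ≫ h₀ - 𝟙 _ :=
    ⟨hS.exact.liftFromProjective (s₀ ≫ h₀ - 𝟙 _)
      (by rw [Preadditive.sub_comp, Category.assoc, hh₀, hs₀, Category.id_comp, sub_self]),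
      hS.exact.liftFromProjective_comp _ _⟩
  obtain ⟨χ, hχ⟩ := P.exists_d_comp_eq_of_subsingleton_ext_one R h (h₁ ≫ φ) (by
    rw [← Category.assoc]
    have : P.complex.d 2 1 ≫ h₁ = 0 := by
      rw [← cancel_mono S.f, Category.assoc, hh₁]
      simp
    rw [this, Limits.zero_comp])
  have key : s₁ ≫ h₁ = 𝟙 _ + S.f ≫ k := by
    rw [← cancel_mono S.f, Category.assoc, hh₁, ← Category.assoc, hs₁]
    simp [hk]
  refine ⟨s₀ ≫ χ - k ≫ φ, ?_⟩
  rw [Preadditive.comp_sub, ← Category.assoc, ← hs₁, Category.assoc, hχ, ← Category.assoc, key]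
  simp

theorem LinearMap.exists_comp_eq_of_subsingleton_ext_one {R M N P Q : Type u} [CommRing R]
    [AddCommGroup M] [Module R M] [AddCommGroup N] [Module R N] [AddCommGroup P] [Module R P]
    [AddCommGroup Q] [Module R Q] [Module.Projective R M] [Module.Projective R N]
    {i : M →ₗ[R] N} {p : N →ₗ[R] P} (hip : Function.Exact i p) (hi : Function.Injective i)
    (hp : Function.Surjective p)
    (h : Subsingleton (((Ext R (ModuleCat.{u} R) 1).obj
      (Opposite.op (ModuleCat.of R P))).obj (ModuleCat.of R Q)))
    (φ : M →ₗ[R] Q) : ∃ ψ : N →ₗ[R] Q, ψ ∘ₗ i = φ := by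
  let S : ShortComplex (ModuleCat.{u} R) :=
    ShortComplex.mk (ModuleCat.ofHom i) (ModuleCat.ofHom p) (by
      ext x
      exact hip.apply_apply_eq_zero x)
  have hS : S.ShortExact := ModuleCat.shortComplex_shortExact S hip hi hp
  have : Projective S.X₁ := (IsProjective.iff_projective M).1 inferInstance
  have : Projective S.X₂ := (IsProjective.iff_projective N).1 inferInstance
  obtain ⟨ψ, hψ⟩ := hS.exists_comp_eq_of_subsingleton_ext_one R h (ModuleCat.ofHom φ)
  exact ⟨ψ.hom, congrArg ModuleCat.Hom.hom hψ⟩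

namespace Localization.Away

variable {A : Type u} [CommRing A] (f : A)

/-- The quotient map `A[X] → A[1/f]` sending `X` to `1/f`. -/
noncomputable def ofPolynomial : A[X] →ₗ[A] Localization.Away f :=
  (Localization.awayEquivAdjoin f).symm.toLinearMap ∘ₗ
    (AdjoinRoot.mkₐ (C f * X - 1)).toLinearMap

theorem ofPolynomial_surjective : Function.Surjective (ofPolynomial f) :=
  (Localization.awayEquivAdjoin f).symm.surjective.comp AdjoinRoot.mk_surjective

theorem ofPolynomial_eq_zero_iff {p : A[X]} : ofPolynomial f p = 0 ↔ C f * X - 1 ∣ p := by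
  rw [← AdjoinRoot.mk_eq_zero]
  exact map_eq_zero_iff _ (Localization.awayEquivAdjoin f).symm.injective

theorem exact_mulLeft_ofPolynomial :
    Function.Exact (LinearMap.mulLeft A (C f * X - 1 : A[X])) (ofPolynomial f) := fun _ =>
  (ofPolynomial_eq_zero_iff f).trans
    ⟨fun ⟨q, hq⟩ => ⟨q, hq.symm⟩, fun ⟨q, hq⟩ => ⟨q, hq.symm⟩⟩

theorem mulLeft_C_mul_X_sub_one_injective :
    Function.Injective (LinearMap.mulLeft A (C f * X - 1 : A[X])) := by
  rw [injective_iff_map_eq_zero]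
  intro p hp
  have hp' : p = C f * X * p := by
    have : (C f * X - 1) * p = 0 := hp
    linear_combination -this
  ext n
  induction n with
  | zero => rw [hp', mul_assoc, coeff_C_mul]; simp
  | succ n ih => rw [hp', mul_assoc, coeff_C_mul, coeff_X_mul, ih]; simp

end Localization.Away

section DerivedComplete

variable {A : Type u} [CommRing A] {f : A}

theorem DerivedComplete.exists_sub_mul_succ_eq (h : DerivedComplete A f A) (a : ℕ → A) :
    ∃ b : ℕ → A, ∀ n, b n - f * b (n + 1) = a n := by
  let φ : A[X] →ₗ[A] A := (basisMonomials A).constr A a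
  have hφ (n : ℕ) : φ (X ^ n) = a n := by
    simpa [X_pow_eq_monomial] using (basisMonomials A).constr_basis A a n
  obtain ⟨ψ, hψ⟩ := LinearMap.exists_comp_eq_of_subsingleton_ext_one
    (Localization.Away.exact_mulLeft_ofPolynomial f)
    (Localization.Away.mulLeft_C_mul_X_sub_one_injective f)
    (Localization.Away.ofPolynomial_surjective f) h.2 φ
  refine ⟨fun n => -ψ (X ^ n), fun n => ?_⟩
  have hX : (C f * X - 1 : A[X]) * X ^ n = f • X ^ (n + 1) - X ^ n := by
    rw [smul_eq_C_mul]; ring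
  have hn : ψ ((C f * X - 1) * X ^ n) = φ (X ^ n) := LinearMap.congr_fun hψ (X ^ n)
  rw [hφ, hX, map_sub, map_smul, smul_eq_mul] at hn
  rw [← hn]; ring

theorem DerivedComplete.eq_zero_of_eq_mul_succ (h : DerivedComplete A f A) {t : ℕ → A}
    (ht : ∀ n, t n = f * t (n + 1)) (n : ℕ) : t n = 0 := by
  let φ : A[X] →ₗ[A] A := (basisMonomials A).constr A t
  have hφ (n : ℕ) : φ (X ^ n) = t n := by
    simpa [X_pow_eq_monomial] using (basisMonomials A).constr_basis A t n
  have hker : LinearMap.ker (Localization.Away.ofPolynomial f) ≤ LinearMap.ker φ := by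
    intro p hp
    obtain ⟨q, rfl⟩ := (Localization.Away.ofPolynomial_eq_zero_iff f).1 hp
    have : φ ∘ₗ LinearMap.mulLeft A (C f * X - 1 : A[X]) = 0 := by
      refine (basisMonomials A).ext fun m => ?_
      have hX : (C f * X - 1 : A[X]) * X ^ m = f • X ^ (m + 1) - X ^ m := by
        rw [smul_eq_C_mul]; ring
      simp [← X_pow_eq_monomial, hX, hφ, ← ht m]
    exact LinearMap.congr_fun this q
  let e := (Localization.Away.ofPolynomial f).quotKerEquivOfSurjective
    (Localization.Away.ofPolynomial_surjective f)
  have h0 := h.1 ((Submodule.liftQ _ φ hker) ∘ₗ e.symm.toLinearMap)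
  have := LinearMap.congr_fun h0 (e (Submodule.Quotient.mk (X ^ n)))
  simpa [hφ] using this

theorem DerivedComplete.eq_zero_of_forall_pow_dvd (hf : f ∈ nonZeroDivisors A)
    (h : DerivedComplete A f A) {x : A} (hx : ∀ n, f ^ n ∣ x) : x = 0 := by
  choose t ht using hx
  have key : ∀ n, t n = f * t (n + 1) := fun n => by
    rw [← mul_cancel_left_mem_nonZeroDivisors (pow_mem hf n), ← ht n, ht (n + 1)]
    ring
  rw [ht 0, h.eq_zero_of_eq_mul_succ key, mul_zero]

theorem pow_span_pair_le (x y : A) (n : ℕ) :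
    Ideal.span {x, y} ^ (n + n) ≤ Ideal.span {x ^ n, y ^ n} := by
  rw [Ideal.span_insert, Ideal.span_insert, ← Ideal.span_singleton_pow,
    ← Ideal.span_singleton_pow]
  exact Ideal.sup_pow_add_le_pow_sup_pow

theorem DerivedComplete.isPrecomplete_span_pair {ξ : A} (hξ : DerivedComplete A ξ A)
    (hf : DerivedComplete A f A) : IsPrecomplete (Ideal.span {ξ, f}) A where
  prec' x hx := by
    simp only [smul_eq_mul, Ideal.mul_top, SModEq.sub_mem] at hx ⊢
    have hstep (n : ℕ) : ∃ a b, a * ξ ^ n + b * f ^ n = x (n + 1 + (n + 1)) - x (n + n) := by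
      rw [← Ideal.mem_span_pair]
      refine pow_span_pair_le ξ f n ?_
      rw [← neg_sub, neg_mem_iff]
      exact hx (by lia)
    choose a b hab using hstep
    obtain ⟨u, hu⟩ := hξ.exists_sub_mul_succ_eq a
    obtain ⟨v, hv⟩ := hf.exists_sub_mul_succ_eq b
    have hsum (n : ℕ) : x (n + n) - (x 0 + u 0 + v 0) = -(u n * ξ ^ n + v n * f ^ n) := by
      induction n with
      | zero => simp; ring
      | succ n ih =>
        linear_combination ih - hab n - ξ ^ n * hu n - f ^ n * hv n
    refine ⟨x 0 + u 0 + v 0, fun n => ?_⟩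
    rw [← sub_add_sub_cancel _ (x (n + n)), hsum]
    have hξI : ξ ^ n ∈ Ideal.span {ξ, f} ^ n :=
      Ideal.pow_mem_pow (Ideal.subset_span (by simp)) n
    have hfI : f ^ n ∈ Ideal.span {ξ, f} ^ n :=
      Ideal.pow_mem_pow (Ideal.subset_span (by simp)) n
    exact add_mem (hx (by lia))
      (neg_mem (add_mem (Ideal.mul_mem_left _ _ hξI) (Ideal.mul_mem_left _ _ hfI)))

/-- If `A` is derived `f`-complete and `A/ξA` has bounded `f^∞`-torsion, then `A/ξA` is
`f`-adically separated. -/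
theorem DerivedComplete.dvd_of_forall_mem_span_pow {ξ : A} (hf : DerivedComplete A f A) {c : ℕ}
    (hc : ∀ a n, ξ ∣ f ^ n * a → ξ ∣ f ^ c * a) {x : A}
    (hx : ∀ n, x ∈ Ideal.span {ξ, f ^ n}) : ξ ∣ x := by
  simp only [Ideal.mem_span_pair] at hx
  choose w y hy using hx
  have hz (n : ℕ) : ξ ∣ f ^ c * (y (n + c) - f * y (n + 1 + c)) :=
    hc _ (n + c) ⟨w (n + 1 + c) - w (n + c), by
      linear_combination hy (n + c) - hy (n + 1 + c)⟩
  choose z hz using hz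
  obtain ⟨v, hv⟩ := hf.exists_sub_mul_succ_eq z
  have := hf.eq_zero_of_eq_mul_succ (t := fun n => f ^ c * y (n + c) - ξ * v n)
    (fun n => by linear_combination hz n - ξ * hv n) 0
  refine ⟨w c + v 0, ?_⟩
  simp only [zero_add] at this
  linear_combination this - hy c

end DerivedComplete

/-- If `ξ, f ∈ A` are nonzerodivisors, `A` is derived `ξ`-complete and
derived `f`-complete, and `A/ξA` has bounded `f^∞`-torsion, then `A` is classically
`(ξ,f)`-adically complete. -/
theorem isAdicComplete_of_prismaticType (A : Type u) [CommRing A] (ξ f : A)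
    (hξ : ξ ∈ nonZeroDivisors A) (hf : f ∈ nonZeroDivisors A)
    (hderξ : DerivedComplete A ξ A) (hderf : DerivedComplete A f A)
    (hbdd : ∃ c : ℕ, ∀ a : A, (∃ n : ℕ, f ^ n * a ∈ Ideal.span {ξ}) → f ^ c * a ∈ Ideal.span {ξ}) :
    IsAdicComplete (Ideal.span {ξ, f}) A := by
  obtain ⟨c, hc⟩ := hbdd
  simp only [Ideal.mem_span_singleton] at hc
  have hc' : ∀ a n, ξ ∣ f ^ n * a → ξ ∣ f ^ c * a := fun a n h => hc a ⟨n, h⟩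
  have hdiv (x : A) (hx : ∀ n, x ∈ Ideal.span {ξ ^ n, f ^ n}) :
      ∃ y, x = ξ * y ∧ ∀ n, y ∈ Ideal.span {ξ ^ n, f ^ n} := by
    obtain ⟨y, rfl⟩ := hderf.dvd_of_forall_mem_span_pow hc' (x := x) fun n => by
      rcases n with _ | n
      · exact Ideal.mem_span_pair.2 ⟨0, x, by simp⟩
      · obtain ⟨a, b, hab⟩ := Ideal.mem_span_pair.1 (hx (n + 1))
        exact Ideal.mem_span_pair.2 ⟨a * ξ ^ n, b, by linear_combination hab⟩
    refine ⟨y, rfl, fun n => ?_⟩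
    obtain ⟨a, b, hab⟩ := Ideal.mem_span_pair.1 (hx (n + c + 1))
    obtain ⟨w, hw⟩ := hc' b (n + c + 1) ⟨y - a * ξ ^ (n + c), by linear_combination hab⟩
    refine Ideal.mem_span_pair.2 ⟨a * ξ ^ c, w * f, ?_⟩
    rw [← mul_cancel_left_mem_nonZeroDivisors hξ]
    linear_combination hab - f ^ (n + 1) * hw
  have hpow (n : ℕ) : ∀ x : A, (∀ n, x ∈ Ideal.span {ξ ^ n, f ^ n}) → ξ ^ n ∣ x := by
    induction n with
    | zero => simp
    | succ n ih =>
      intro x hx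
      obtain ⟨y, rfl, hy⟩ := hdiv x hx
      rw [pow_succ']
      exact mul_dvd_mul_left ξ (ih y hy)
  refine { toIsPrecomplete := hderξ.isPrecomplete_span_pair hderf, haus' := fun x hx => ?_ }
  simp only [smul_eq_mul, Ideal.mul_top, SModEq.zero] at hx
  exact hderξ.eq_zero_of_forall_pow_dvd hξ fun n =>
    hpow n x fun m => pow_span_pair_le ξ f m (hx (m + m))
end
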